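/- Let C be a diamond category and let W̄ ⊆ W be narrow formations such that for every G ∈ W the canonical epimorphism G → G^{W̄} is semisimple. Let E be an object of C and H̄ ∈ W̄. If (M_G)_G is well-behaved at a narrow formation W̃ containing W and E, then ∑_{G ∈ I} ∑_{F ∈ I, F^{W̄} ≅ H̄} ∑_{π ∈ Epi(G,F)} ∑_{ρ ∈ Epi(F,E), ρ∘π relative-W} |μ(π)·M_G| / (|Aut(F)|·|Aut(G)|) < ∞, where I is the set of isomorphism classes of C. -/

import Mathlib

open CategoryTheory Opposite Filter Topology MeasureTheory
open scoped ENNReal Classical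

universe u

namespace MomentCat

variable {C : Type u} [SmallCategory C]

/-- The poset of isomorphism classes of quotient objects of `G`,
realized as subobjects of `op G` in `Cᵒᵖ`.  The order is: `a ≤ b` iff `a` is a
further quotient of `b`, so that `⊤` is the class of the identity `G → G`. -/
abbrev Quotients (G : C) := Subobject (op G)

/-- The join of two quotient classes (the least upper bound, when it exists). -/
noncomputable def qSup {G : C} (a b : Quotients G) : Quotients G :=
  if h : ∃ c, IsLUB {a, b} c then h.choose else a

/-- The meet of two quotient classes (the greatest lower bound, when it exists). -/
noncomputable def qInf {G : C} (a b : Quotients G) : Quotients G :=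
  if h : ∃ c, IsGLB {a, b} c then h.choose else a

/-- The join of a set of quotient classes (when it exists). -/
noncomputable def qsSup {G : C} (s : Set (Quotients G)) : Quotients G :=
  if h : ∃ c, IsLUB s c then h.choose else ⊤

/-- The quotient class determined by an epimorphism `π : G ⟶ F`. -/
noncomputable def quotOf {G F : C} (π : G ⟶ F) (h : Epi π) : Quotients G :=
  haveI := h
  Subobject.mk π.op

/-- The underlying object of a quotient class. -/
noncomputable def qObj {G : C} (a : Quotients G) : C :=
  unop (Subobject.underlying.obj a)

/-- An object is minimal if its only quotient is itself. -/
def IsMinimalObj (G : C) : Prop := Subsingleton (Quotients G)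

/-- An epimorphism is simple if it is not an isomorphism and the interval
`[F, G]` contains only the two endpoints. -/
def IsSimpleEpi {G F : C} (π : G ⟶ F) : Prop :=
  ∃ h : Epi π, ¬IsIso π ∧ ∀ X : Quotients G, quotOf π h ≤ X → X = quotOf π h ∨ X = ⊤

/-- The interval `[a, ⊤]` is a complemented lattice. -/
def IntervalComplTop {G : C} (a : Quotients G) : Prop :=
  ∀ X : Quotients G, a ≤ X → ∃ Y : Quotients G, a ≤ Y ∧ qSup X Y = ⊤ ∧ qInf X Y = a

/-- The interval `[a, b]` is a complemented lattice. -/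
def IntervalCompl {G : C} (a b : Quotients G) : Prop :=
  ∀ X : Quotients G, a ≤ X → X ≤ b →
    ∃ Y : Quotients G, a ≤ Y ∧ Y ≤ b ∧ qSup X Y = b ∧ qInf X Y = a

/-- An epimorphism `π : G ⟶ F` is semisimple if the interval `[F,G]` is complemented. -/
def IsSemisimpleEpi {G F : C} (π : G ⟶ F) : Prop :=
  ∃ h : Epi π, IntervalComplTop (quotOf π h)

/-- A set of objects (stable under isomorphism) closed under quotients. -/
def DownwardClosed (S : Set C) : Prop :=
  ∀ G ∈ S, ∀ (F : C) (π : G ⟶ F), Epi π → F ∈ S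

/-- A set of objects closed under joins of quotients of a common object. -/
def JoinClosed (S : Set C) : Prop :=
  ∀ (G : C) (a b : Quotients G), qObj a ∈ S → qObj b ∈ S →
    (∃ c, IsLUB {a, b} c) → qObj (qSup a b) ∈ S

/-- A set of objects containing all minimal objects. -/
def MinClosed (S : Set C) : Prop := ∀ G : C, IsMinimalObj G → G ∈ S

/-- A formation: downward-closed, join-closed, containing all minimal objects. -/
def IsFormation (S : Set C) : Prop := DownwardClosed S ∧ JoinClosed S ∧ MinClosed S

/-- The smallest downward-closed join-closed set containing `B` and all minimal objects. -/
def levelGen (B : Set C) : Set C := ⋂₀ {S : Set C | IsFormation S ∧ B ⊆ S}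

/-- A level is a formation generated by a finite set of objects. -/
def IsLevel (S : Set C) : Prop := ∃ B : Set C, B.Finite ∧ S = levelGen B

/-- The type of isomorphism classes of objects of `C`. -/
abbrev IsoCls (C : Type u) [SmallCategory C] := Quotient (CategoryTheory.isIsomorphicSetoid C)

/-- The isomorphism class of an object. -/
def cls (G : C) : IsoCls C := Quotient.mk (CategoryTheory.isIsomorphicSetoid C) G

/-- The set of epimorphisms from `G` to `F`. -/
abbrev Epis (G F : C) := {π : G ⟶ F // Epi π}

/-- There is a chain of covers of length `d` from `a` to `b` (i.e. the morphism
`qObj b → qObj a` has dimension `d`). -/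
def CovChain {G : C} (a b : Quotients G) (d : ℕ) : Prop :=
  ∃ c : Fin (d + 1) → Quotients G, c 0 = a ∧ c (Fin.last d) = b ∧
    ∀ i : Fin d, c i.castSucc ⋖ c i.succ

/-- An epimorphism has dimension `d`. -/
def EpiDim {G F : C} (π : G ⟶ F) (h : Epi π) (d : ℕ) : Prop :=
  CovChain (quotOf π h) ⊤ d

/-- A set of isomorphism classes is narrow if each of its members receives simple
epimorphisms from only finitely many of its members (up to isomorphism). -/
def Narrow (S : Set C) : Prop :=
  ∀ G ∈ S, {X : IsoCls C | X.out ∈ S ∧ ∃ π : X.out ⟶ G, IsSimpleEpi π}.Finite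

/-- The minimal quotient: the bottom of the quotient poset, when it exists. -/
noncomputable def qBot (G : C) : Quotients G :=
  if h : ∃ b : Quotients G, ∀ x, b ≤ x then h.choose else ⊤

/-- `G` has complexity at most `k`: the map to the minimal quotient is a
composition of `k` semisimple epimorphisms. -/
def complexityLE (G : C) (k : ℕ) : Prop :=
  ∃ c : Fin (k + 1) → Quotients G, c 0 = qBot G ∧ c (Fin.last k) = ⊤ ∧
    ∀ i : Fin k, c i.castSucc ≤ c i.succ ∧ IntervalCompl (c i.castSucc) (c i.succ)

/-- A diamond category. -/
structure IsDiamond (C : Type u) [SmallCategory C] : Prop where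
  /-- quotient posets are finite … -/
  quotFinite : ∀ G : C, Finite (Quotients G)
  /-- … and are lattices: all pairwise joins exist … -/
  lub : ∀ (G : C) (a b : Quotients G), ∃ c, IsLUB {a, b} c
  /-- … and all pairwise meets exist … -/
  glb : ∀ (G : C) (a b : Quotients G), ∃ c, IsGLB {a, b} c
  /-- … and are modular. -/
  modular : ∀ (G : C) (a b x : Quotients G), a ≤ b →
    qSup a (qInf x b) = qInf (qSup a x) b
  /-- automorphism groups are finite -/
  autFinite : ∀ G : C, Finite (Aut G)
  /-- levels are narrow -/
  levelNarrow : ∀ S : Set C, IsLevel S → Narrow S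
  /-- countably many isomorphism classes of minimal objects -/
  minCountable : Set.Countable {X : IsoCls C | IsMinimalObj X.out}

/-- A family assigning to each object the Möbius function of its quotient poset:
`mob G x x = 1` and for `x < y`, `∑_{x ≤ z ≤ y} mob G x z = 0`. -/
def IsMobiusFamily (mob : ∀ G : C, Quotients G → Quotients G → ℝ) : Prop :=
  ∀ G : C, (∀ x : Quotients G, mob G x x = 1) ∧
    ∀ x y : Quotients G, x < y → ∑ᶠ z ∈ Set.Icc x y, mob G x z = 0

/-- `μ(π) = μ(F, G)` for an epimorphism `π : G ⟶ F`. -/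
noncomputable def muEpi (mob : ∀ G : C, Quotients G → Quotients G → ℝ)
    {G F : C} (π : G ⟶ F) (h : Epi π) : ℝ :=
  mob G (quotOf π h) ⊤

/-- `μ̂(F,G) = ∑_{π ∈ Epi(G,F)/Aut(F)} μ(π) = (∑_{π ∈ Epi(G,F)} μ(π))/|Aut F|`
(the `Aut F`-action on epimorphisms being free). -/
noncomputable def muHat (mob : ∀ G : C, Quotients G → Quotients G → ℝ) (F G : C) : ℝ :=
  (∑' π : Epis G F, muEpi mob π.1 π.2) / (Nat.card (Aut F) : ℝ)

/-- `S_{G,F} = |Epi(G,F)|/|Aut F|`. -/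
noncomputable def SQ (G F : C) : ℝ :=
  (Nat.card (Epis G F) : ℝ) / (Nat.card (Aut F) : ℝ)

/-- `T_{G,F} = μ̂(F,G)`. -/
noncomputable def TQ (mob : ∀ G : C, Quotients G → Quotients G → ℝ) (G F : C) : ℝ :=
  muHat mob F G

/-- `Z(π)`: the number of `H ∈ [F,G]` satisfying the distributive law. -/
noncomputable def Zfn {G F : C} (π : G ⟶ F) (h : Epi π) : ℕ :=
  Nat.card {H : Quotients G // quotOf π h ≤ H ∧ ∀ K₁ K₂ : Quotients G,
    quotOf π h ≤ K₁ → quotOf π h ≤ K₂ →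
      qSup H (qInf K₁ K₂) = qInf (qSup H K₁) (qSup H K₂)}

/-- The isomorphism classes lying in `W`. -/
abbrev WSub (W : Set C) := {X : IsoCls C // X.out ∈ W}

/-- `(M_G)` is well-behaved at `W`:
`∑_{G ∈ W} ∑_{π ∈ Epi(G,F)} (|μ(F,G)|/|Aut G|) Z(π)³ |M_G| < ∞` for every `F ∈ W`. -/
def WellBehavedAt (mob : ∀ G : C, Quotients G → Quotients G → ℝ) (M : IsoCls C → ℝ)
    (W : Set C) : Prop :=
  ∀ F : C, F ∈ W → Summable (fun q : Σ X : WSub W, Epis X.1.out F =>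
    |mob q.1.1.out (quotOf q.2.1 q.2.2) ⊤| / (Nat.card (Aut q.1.1.out) : ℝ)
      * ((Zfn q.2.1 q.2.2 : ℝ)) ^ 3 * |M q.1.1|)

/-- The `W`-quotient `G^W`: the join of all quotients of `G` lying in `W`. -/
noncomputable def wQuot (W : Set C) (G : C) : Quotients G :=
  qsSup {a : Quotients G | qObj a ∈ W}

/-- An epimorphism `φ : G ⟶ E` is relative-`W` if `G → G^W ∨ E` is an isomorphism. -/
def RelativeW (W : Set C) {G E : C} (φ : G ⟶ E) (h : Epi φ) : Prop :=
  qSup (wQuot W G) (quotOf φ h) = ⊤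

/-- `v_{W,F} = ∑_{G ∈ W} μ̂(F,G) M_G / |Aut G|`. -/
noncomputable def vWF (mob : ∀ G : C, Quotients G → Quotients G → ℝ) (M : IsoCls C → ℝ)
    (W : Set C) (F : C) : ℝ :=
  ∑' X : WSub W, muHat mob F X.1.out * M X.1 / (Nat.card (Aut X.1.out) : ℝ)

theorem epiComp {G F E : C} {π : G ⟶ F} {ρ : F ⟶ E} (h1 : Epi π) (h2 : Epi ρ) :
    Epi (π ≫ ρ) := by
  haveI := h1; haveI := h2; infer_instance

/-- The radical of an epimorphism with class `a`: the join of all minimal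
elements of `[a, ⊤]` distinct from `a` (together with `a` itself). -/
noncomputable def radicalEl {G : C} (a : Quotients G) : Quotients G :=
  qsSup (insert a {X : Quotients G | a ⋖ X})

end MomentCat


set_option linter.style.haveILetI false

namespace MomentCat

section LatticePart

set_option linter.unusedSectionVars false

variable {L : Type*} [Lattice L] [OrderBot L] [IsModularLattice L] [Fintype L]

/-- The number of atoms below `x` but not below `c`. -/
noncomputable def newAtoms (x c : L) : Finset L :=
  Finset.univ.filter (fun p => IsAtom p ∧ p ≤ x ∧ ¬ p ≤ c)

theorem sup_eq_of_cov {c x p : L} (h : c ⋖ x) (hp : p ≤ x) (hpc : ¬ p ≤ c) : c ⊔ p = x := by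
  rcases h.eq_or_eq (le_sup_left (b := p)) (sup_le h.le hp) with h1 | h1
  · exact absurd (sup_eq_left.1 h1) hpc
  · exact h1

theorem atom_inf_bot {p c : L} (h : IsAtom p) (hpc : ¬ p ≤ c) : p ⊓ c = ⊥ := by
  rcases h.le_iff.1 (inf_le_left (b := c)) with h1 | h1
  · exact h1
  · exact absurd (inf_eq_left.1 h1) hpc

theorem sum_above_atom (g : L → ℝ) {c x p : L} (h : c ⋖ x) (ha : IsAtom p) (hp : p ≤ x)
    (hpc : ¬ p ≤ c) :
    ∑ y ∈ Finset.univ.filter (fun y => p ≤ y ∧ y ≤ x), g (y ⊓ c) =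
      ∑ z ∈ Finset.univ.filter (fun z => z ≤ c), g z := by
  refine Finset.sum_bij' (fun y _ => y ⊓ c) (fun z _ => z ⊔ p) ?_ ?_ ?_ ?_ ?_
  · intro y hy; simp
  · intro z hz
    simp only [Finset.mem_filter, Finset.mem_univ, true_and] at hz ⊢
    exact ⟨le_sup_right, sup_le (hz.trans h.le) hp⟩
  · intro y hy
    simp only [Finset.mem_filter, Finset.mem_univ, true_and] at hy
    have := sup_eq_of_cov h hp hpc
    rw [sup_comm, inf_comm, ← sup_inf_assoc_of_le c hy.1, sup_comm, this, inf_eq_right.2 hy.2]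
  · intro z hz
    simp only [Finset.mem_filter, Finset.mem_univ, true_and] at hz
    rw [sup_inf_assoc_of_le p hz, atom_inf_bot ha hpc, sup_bot_eq]
  · intro y hy; rfl

theorem newAtoms_inf (y c : L) : newAtoms y (y ⊓ c) = newAtoms y c := by
  ext p; simp only [newAtoms, Finset.mem_filter, Finset.mem_univ, true_and, le_inf_iff]; tauto

theorem sum_new (g : L → ℝ) {c x : L} (h : c ⋖ x) :
    ∑ y ∈ Finset.univ.filter (fun y => y ≤ x ∧ ¬ y ≤ c), ((newAtoms y c).card : ℝ) * g (y ⊓ c) =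
      (newAtoms x c).card * ∑ z ∈ Finset.univ.filter (fun z => z ≤ c), g z := by
  have h1 : ∀ y ∈ Finset.univ.filter (fun y => y ≤ x ∧ ¬ y ≤ c),
      ((newAtoms y c).card : ℝ) * g (y ⊓ c) =
      ∑ p ∈ newAtoms x c, if p ≤ y then g (y ⊓ c) else 0 := by
    intro y hy
    simp only [Finset.mem_filter, Finset.mem_univ, true_and] at hy
    rw [← Finset.sum_filter, Finset.sum_const, nsmul_eq_mul]
    congr 3
    ext p
    simp only [newAtoms, Finset.mem_filter, Finset.mem_univ, true_and]
    constructor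
    · rintro ⟨a, b, c⟩; exact ⟨⟨a, b.trans hy.1, c⟩, b⟩
    · rintro ⟨⟨a, b, c⟩, d⟩; exact ⟨a, d, c⟩
  rw [Finset.sum_congr rfl h1, Finset.sum_comm]
  have h2 : ∀ p ∈ newAtoms x c,
      ∑ y ∈ Finset.univ.filter (fun y => y ≤ x ∧ ¬ y ≤ c), (if p ≤ y then g (y ⊓ c) else 0)
        = ∑ z ∈ Finset.univ.filter (fun z => z ≤ c), g z := by
    intro p hp
    simp only [newAtoms, Finset.mem_filter, Finset.mem_univ, true_and] at hp
    rw [← sum_above_atom g h hp.1 hp.2.1 hp.2.2, ← Finset.sum_filter, Finset.filter_filter]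
    congr 1
    ext y
    simp only [Finset.mem_filter, Finset.mem_univ, true_and]
    constructor
    · rintro ⟨⟨a, b⟩, c⟩; exact ⟨c, a⟩
    · rintro ⟨a, b⟩; exact ⟨⟨b, fun hh => hp.2.2 (a.trans hh)⟩, a⟩
  rw [Finset.sum_congr rfl h2, Finset.sum_const, nsmul_eq_mul]

/-- The defining property of `x ↦ μ(⊥, x)`. -/
def IsMobBot (m : L → ℝ) : Prop :=
  m ⊥ = 1 ∧ ∀ x : L, x ≠ ⊥ → ∑ y ∈ Finset.univ.filter (fun y => y ≤ x), m y = 0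

theorem inf_cov {c x y : L} (h : c ⋖ x) (hy : y ≤ x) (hyc : ¬ y ≤ c) : y ⊓ c ⋖ y := by
  have := sup_eq_of_cov h hy hyc
  rw [inf_comm]
  apply inf_covBy_of_covBy_sup_left
  rwa [this]

theorem mob_cov {m : L → ℝ} (hm : IsMobBot m) : ∀ (x c : L), c ⋖ x →
    m x = - ((newAtoms x c).card : ℝ) * m c := by
  intro x
  induction x using WellFoundedLT.induction with
  | _ x ih =>
  intro c h
  by_cases hc : c = ⊥
  · subst hc
    have hx : IsAtom x := bot_covBy_iff.1 h
    have e1 : newAtoms x ⊥ = {x} := by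
      ext p
      simp only [newAtoms, Finset.mem_filter, Finset.mem_univ, true_and, Finset.mem_singleton]
      constructor
      · rintro ⟨a, b, c⟩
        exact (hx.le_iff_eq a.1).1 b
      · rintro rfl; exact ⟨hx, le_rfl, fun hh => hx.1 (le_bot_iff.1 hh)⟩
    have e2 := hm.2 x hx.1
    have e3 : Finset.univ.filter (fun y => y ≤ x) = {⊥, x} := by
      ext y
      simp [hx.le_iff]
    rw [e3, Finset.sum_pair hx.1.symm, hm.1] at e2
    rw [e1, hm.1]; simp; linarith
  · have hx : x ≠ ⊥ := fun hh => hc (le_bot_iff.1 (hh ▸ h.le))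
    have e1 := hm.2 x hx
    have e2 := hm.2 c hc
    have e3 := sum_new m h
    rw [e2, mul_zero] at e3
    have s1 : Finset.univ.filter (fun y => y ≤ x) =
       Finset.univ.filter (fun y => y ≤ c) ∪ Finset.univ.filter (fun y => y ≤ x ∧ ¬ y ≤ c) := by
      ext y
      simp only [Finset.mem_filter, Finset.mem_univ, true_and, Finset.mem_union]
      have : y ≤ c → y ≤ x := fun hh => hh.trans h.le
      tauto
    rw [s1, Finset.sum_union, e2, zero_add] at e1
    · have hmem : x ∈ Finset.univ.filter (fun y => y ≤ x ∧ ¬ y ≤ c) := by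
        simp [h.lt.not_ge]
      rw [← Finset.add_sum_erase _ _ hmem] at e1 e3
      have e4 : ∑ y ∈ (Finset.univ.filter (fun y => y ≤ x ∧ ¬ y ≤ c)).erase x, m y =
        - ∑ y ∈ (Finset.univ.filter (fun y => y ≤ x ∧ ¬ y ≤ c)).erase x,
          ((newAtoms y c).card : ℝ) * m (y ⊓ c) := by
        rw [← Finset.sum_neg_distrib]
        apply Finset.sum_congr rfl
        intro y hy
        simp only [Finset.mem_erase, Finset.mem_filter, Finset.mem_univ, true_and] at hy
        rw [ih y (lt_of_le_of_ne hy.2.1 hy.1) (y ⊓ c) (inf_cov h hy.2.1 hy.2.2), newAtoms_inf]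
        ring
      rw [e4] at e1
      rw [inf_eq_right.2 h.le] at e3
      linarith
    · rw [Finset.disjoint_left]
      intro y hy hy'
      simp only [Finset.mem_filter, Finset.mem_univ, true_and] at hy hy'
      exact hy'.2 hy

theorem abs_sum_cov {m : L → ℝ} (hm : IsMobBot m) {x c : L} (h : c ⋖ x) :
    ∑ y ∈ Finset.univ.filter (fun y => y ≤ x), |m y| =
      (1 + (newAtoms x c).card) * ∑ y ∈ Finset.univ.filter (fun y => y ≤ c), |m y| := by
  have s1 : Finset.univ.filter (fun y => y ≤ x) =
     Finset.univ.filter (fun y => y ≤ c) ∪ Finset.univ.filter (fun y => y ≤ x ∧ ¬ y ≤ c) := by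
    ext y
    simp only [Finset.mem_filter, Finset.mem_univ, true_and, Finset.mem_union]
    have : y ≤ c → y ≤ x := fun hh => hh.trans h.le
    tauto
  rw [s1, Finset.sum_union]
  · rw [add_mul, one_mul, ← sum_new (fun y => |m y|) h]
    congr 1
    apply Finset.sum_congr rfl
    intro y hy
    simp only [Finset.mem_filter, Finset.mem_univ, true_and] at hy
    rw [mob_cov hm y (y ⊓ c) (inf_cov h hy.1 hy.2), newAtoms_inf, abs_mul, abs_neg]
    simp
  · rw [Finset.disjoint_left]
    intro y hy hy'
    simp only [Finset.mem_filter, Finset.mem_univ, true_and] at hy hy'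
    exact hy'.2 hy

/-- `x` is the join of the atoms below it. -/
def JA (x : L) : Prop := ∀ c, (∀ p, IsAtom p → p ≤ x → p ≤ c) → x ≤ c

theorem JA_of_mob_ne_zero {m : L → ℝ} (hm : IsMobBot m) {x : L} (hx : m x ≠ 0) : JA x := by
  intro c hc
  by_contra hxc
  have h1 : c ⊓ x < x := lt_of_le_of_ne inf_le_right (fun h => hxc (inf_eq_right.1 h))
  obtain ⟨d, hd, hdx⟩ := exists_le_covBy_of_lt h1
  have := mob_cov hm x d hdx
  have e : newAtoms x d = ∅ := by
    ext p
    simp only [newAtoms, Finset.mem_filter, Finset.mem_univ, true_and, Finset.notMem_empty,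
      iff_false]
    rintro ⟨a, b, e⟩
    exact e (le_trans (le_inf (hc p a b) b) hd)
  rw [e] at this
  simp at this
  exact hx this

theorem JA_sup {x y : L} (hx : JA x) (hy : JA y) : JA (x ⊔ y) := by
  intro c hc
  exact sup_le (hx c fun p a b => hc p a (b.trans le_sup_left))
    (hy c fun p a b => hc p a (b.trans le_sup_right))

theorem JA_atom {x : L} (hx : JA x) {y c : L} (hy : y ≤ x) (hyc : ¬ y ≤ c) :
    ∃ p, IsAtom p ∧ p ≤ y ∧ ¬ p ≤ c := by
  -- complement of `c ⊓ y` inside `x`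
  set c' := c ⊓ y with hc'
  obtain ⟨d, hd⟩ := Set.Finite.exists_maximal (s := {d : L | d ⊓ c' = ⊥}) (Set.toFinite _)
    ⟨⊥, by simp⟩
  have hd1 : d ⊓ c' = ⊥ := hd.1
  have hx1 : x ≤ c' ⊔ d := by
    apply hx
    intro p hp hpx
    by_contra hpn
    have h2 : (d ⊔ p) ⊓ c' = ⊥ := by
      have : p ⊓ (c' ⊔ d) = ⊥ := atom_inf_bot hp hpn
      have h3 : (d ⊔ p) ⊓ (c' ⊔ d) = d := by
        rw [sup_inf_assoc_of_le p le_sup_right, this, sup_bot_eq]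
      have h4 : (d ⊔ p) ⊓ c' ≤ d := by
        calc (d ⊔ p) ⊓ c' ≤ (d ⊔ p) ⊓ (c' ⊔ d) := inf_le_inf_left _ le_sup_left
          _ = d := h3
      exact le_bot_iff.1 ((le_inf h4 inf_le_right).trans hd1.le)
    have h5 : d ⊔ p ≤ d := hd.2 h2 le_sup_left
    exact hpn ((le_sup_right.trans h5).trans le_sup_right)
  have h6 : y ⊓ d ≠ ⊥ := by
    intro h7
    have : y ≤ c' := by
      have h8 : (c' ⊔ d) ⊓ y = c' ⊔ d ⊓ y := sup_inf_assoc_of_le d inf_le_right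
      rw [inf_comm d, h7, sup_bot_eq] at h8
      rw [← h8]; exact le_inf (hy.trans hx1) le_rfl
    exact hyc (this.trans inf_le_left)
  obtain ⟨p, hp, hpy⟩ := (eq_bot_or_exists_atom_le (y ⊓ d)).resolve_left h6
  refine ⟨p, hp, hpy.trans inf_le_left, fun hpc => hp.1 (le_bot_iff.1 ?_)⟩
  rw [← hd1]
  exact le_inf (hpy.trans inf_le_right) (le_inf hpc (hpy.trans inf_le_left))

/-- Every element is the join of the atoms below it. -/
def AtomSep (L : Type*) [Lattice L] [OrderBot L] : Prop :=
  ∀ y c : L, ¬ y ≤ c → ∃ p, IsAtom p ∧ p ≤ y ∧ ¬ p ≤ c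

/-- Perspectivity of atoms. -/
def Persp (p q : L) : Prop := p = q ∨ ∃ r, IsAtom r ∧ r ≠ p ∧ r ≠ q ∧ r ≤ p ⊔ q

theorem cov_sup_atom {c p : L} (hp : IsAtom p) (h : ¬ p ≤ c) : c ⋖ c ⊔ p := by
  apply covBy_sup_of_inf_covBy_right
  rw [inf_comm, atom_inf_bot hp h]
  exact hp.bot_covBy

theorem exch {c p q : L} (hp : IsAtom p) (h : q ≤ c ⊔ p) (hq : ¬ q ≤ c) : c ⊔ q = c ⊔ p := by
  apply sup_eq_of_cov _ h hq
  apply cov_sup_atom hp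
  intro hpc
  exact hq (h.trans (sup_le le_rfl hpc))

theorem atom_le_atom {p q : L} (hp : IsAtom p) (hq : IsAtom q) (h : p ≤ q) : p = q :=
  (hq.le_iff_eq hp.1).1 h

theorem exch2 {p q r : L} (hp : IsAtom p) (hq : IsAtom q) (hr : IsAtom r) (h : r ≤ p ⊔ q)
    (hrp : r ≠ p) : p ⊔ r = p ⊔ q :=
  exch hq h (fun hh => hrp (atom_le_atom hr hp hh))

theorem Persp.symm {p q : L} (h : Persp p q) : Persp q p := by
  rcases h with h | ⟨r, a, b, c, d⟩
  · exact Or.inl h.symm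
  · exact Or.inr ⟨r, a, c, b, by rwa [sup_comm]⟩

theorem projLemma (hA : AtomSep L) {q a b : L} (hq : IsAtom q) (h : q ≤ a ⊔ b) (hqa : ¬ q ≤ a)
    (hqb : ¬ q ≤ b) : ∃ r s, IsAtom r ∧ IsAtom s ∧ r ≤ a ∧ s ≤ b ∧ q ≤ r ⊔ s := by
  have h1 : b ⊔ ((b ⊔ q) ⊓ a) = b ⊔ q := by
    rw [inf_comm, ← sup_inf_assoc_of_le a le_sup_left]
    apply inf_eq_right.2
    exact sup_le le_sup_left (by rwa [sup_comm])
  have h2 : ¬ (b ⊔ q) ⊓ a ≤ b := by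
    intro hh
    rw [sup_eq_left.2 hh] at h1
    exact hqb (by rw [h1]; exact le_sup_right)
  obtain ⟨r, hr, hra, hrb⟩ := hA _ _ h2
  have hrq : r ≠ q := fun hh => hqa (hh ▸ hra.trans inf_le_right)
  have h3 : b ⊔ r = b ⊔ q := exch hq (hra.trans inf_le_left) hrb
  have h4 : r ⊔ ((r ⊔ q) ⊓ b) = r ⊔ q := by
    rw [inf_comm, ← sup_inf_assoc_of_le b le_sup_left]
    apply inf_eq_right.2
    rw [sup_comm r b, h3]
    exact sup_le (hra.trans inf_le_left) le_sup_right
  have h5 : ¬ (r ⊔ q) ⊓ b ≤ r := by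
    intro hh
    rw [sup_eq_left.2 hh] at h4
    have : q ≤ r := by rw [h4]; exact le_sup_right
    exact hrq (atom_le_atom hq hr this).symm
  obtain ⟨s, hs, hsb, hsr⟩ := hA _ _ h5
  refine ⟨r, s, hr, hs, hra.trans inf_le_right, hsb.trans inf_le_right, ?_⟩
  rw [exch hq (hsb.trans inf_le_left) hsr]
  exact le_sup_right

theorem Persp.trans (hA : AtomSep L) {p q r : L} (hp : IsAtom p) (hq : IsAtom q) (hr : IsAtom r)
    (h1 : Persp p q) (h2 : Persp q r) : Persp p r := by
  rcases h1 with rfl | ⟨s, hs, hsp, hsq, hspq⟩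
  · exact h2
  rcases h2 with rfl | ⟨t, ht, htq, htr, htqr⟩
  · exact Or.inr ⟨s, hs, hsp, hsq, hspq⟩
  by_cases hpr : p = r
  · exact Or.inl hpr
  by_cases hqr : q = r
  · subst hqr; exact Or.inr ⟨s, hs, hsp, hsq, hspq⟩
  by_cases hpq : p = q
  · subst hpq; exact Or.inr ⟨t, ht, htq, htr, htqr⟩
  by_cases hc : r ≤ p ⊔ q
  · refine Or.inr ⟨q, hq, fun h => hpq h.symm, hqr, ?_⟩
    rw [exch2 hp hq hr hc (fun h => hpr h.symm)]; exact le_sup_right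
  have e1 : p ⊔ s = p ⊔ q := exch2 hp hq hs hspq hsp
  have e2 : q ⊔ s = p ⊔ q := by
    rw [exch2 hq hp hs (by rwa [sup_comm]) hsq, sup_comm]
  have e3 : q ⊔ t = q ⊔ r := exch2 hq hr ht htqr htq
  have e4 : r ⊔ t = q ⊔ r := by
    rw [exch2 hr hq ht (by rwa [sup_comm]) htr, sup_comm]
  have hst : s ≠ t := by
    rintro rfl
    apply hc
    rw [← e2, e3]; exact le_sup_right
  have k1 : s ≤ (p ⊔ r) ⊔ t := by
    rw [sup_assoc, e4]
    exact hspq.trans (sup_le le_sup_left (le_sup_left.trans le_sup_right))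
  have k2 : ¬ s ≤ p ⊔ r := by
    intro hh
    have : p ⊔ s = p ⊔ r := exch2 hp hr hs hh hsp
    apply hc
    rw [← e1, this]; exact le_sup_right
  have k3 : ¬ s ≤ t := fun hh => hst (atom_le_atom hs ht hh)
  obtain ⟨u, t', hu, ht', hua, hta, hs'⟩ := projLemma hA hs k1 k2 k3
  have : t' = t := atom_le_atom ht' ht hta
  subst this
  refine Or.inr ⟨u, hu, ?_, ?_, hua⟩
  · rintro rfl
    have : u ⊔ s = u ⊔ t' := exch2 hu ht hs hs' hsp
    have h5 : t' ≤ u ⊔ q := by rw [← e1, this]; exact le_sup_right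
    apply hc
    calc r ≤ q ⊔ r := le_sup_right
      _ = q ⊔ t' := e3.symm
      _ ≤ u ⊔ q := sup_le le_sup_right h5
  · rintro rfl
    rw [e4] at hs'
    have : q ⊔ s = q ⊔ u := exch2 hq hr hs hs' hsq
    apply hc
    rw [← e2, this]; exact le_sup_right

/-- The perspectivity setoid on atoms. -/
def perspSetoid (hA : AtomSep L) : Setoid {p : L // IsAtom p} where
  r p q := Persp p.1 q.1
  iseqv := ⟨fun _ => Or.inl rfl, fun h => h.symm, fun {a b c} h1 h2 => h1.trans hA a.2 b.2 c.2 h2⟩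

/-- The classes of atoms. -/
abbrev AtCls (hA : AtomSep L) := Quotient (perspSetoid hA)

/-- Number of atoms of the class `k` below `x`. -/
noncomputable def nCls (hA : AtomSep L) (k : AtCls hA) (x : L) : ℕ :=
  (Finset.univ.filter (fun p : {p : L // IsAtom p} =>
    (Quotient.mk (perspSetoid hA) p) = k ∧ p.1 ≤ x)).card

theorem mk_eq_iff (hA : AtomSep L) (p q : {p : L // IsAtom p}) :
    Quotient.mk (perspSetoid hA) p = Quotient.mk (perspSetoid hA) q ↔ Persp p.1 q.1 := by
  constructor
  · intro h; exact Quotient.exact h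
  · intro h; exact Quotient.sound h

/-- two new atoms are perspective -/
theorem persp_new (hA : AtomSep L) {c x p q : L} (h : c ⋖ x) (hp : IsAtom p) (hq : IsAtom q)
    (hpx : p ≤ x) (hqx : q ≤ x) (hpc : ¬ p ≤ c) (hqc : ¬ q ≤ c) : Persp p q := by
  by_cases hpq : p = q
  · exact Or.inl hpq
  have e := sup_eq_of_cov h hqx hqc
  have h1 : p ≤ c ⊔ q := e ▸ hpx
  obtain ⟨r, s, hr, hs, hrc, hsq, hprs⟩ := projLemma hA hp h1 hpc
    (fun hh => hpq (atom_le_atom hp hq hh))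
  have := atom_le_atom hs hq hsq
  subst this
  have hrp : r ≠ p := fun hh => hpc (hh ▸ hrc)
  have hrs : r ≠ s := fun hh => hqc (hh ▸ hrc)
  refine Or.inr ⟨r, hr, hrp, hrs, ?_⟩
  have : s ⊔ p = s ⊔ r := exch2 hs hr hp (by rwa [sup_comm]) hpq
  rw [sup_comm, this]; exact le_sup_right

theorem card_new_ge (hA : AtomSep L) {c x : L} (h : c ⋖ x) (p : {p : L // IsAtom p})
    (hpx : p.1 ≤ x) (hpc : ¬ p.1 ≤ c) :
    nCls hA (Quotient.mk (perspSetoid hA) p) c + 1 ≤ (newAtoms x c).card := by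
  have key : ∀ r : {p : L // IsAtom p}, Persp r.1 p.1 → r.1 ≤ c →
      ∃ g, IsAtom g ∧ g ≠ r.1 ∧ g ≠ p.1 ∧ g ≤ r.1 ⊔ p.1 := by
    intro r hr hrc
    rcases hr with h1 | h1
    · exact absurd (h1 ▸ hrc) hpc
    · exact h1
  choose! g g1 g2 g3 g4 using key
  set S := Finset.univ.filter (fun q : {p : L // IsAtom p} =>
    (Quotient.mk (perspSetoid hA) q) = (Quotient.mk (perspSetoid hA) p) ∧ q.1 ≤ c) with hS
  have hmem : ∀ q, q ∈ S ↔ Persp q.1 p.1 ∧ q.1 ≤ c := by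
    intro q; simp [hS, mk_eq_iff]
  have hpn : p.1 ∉ S.image g := by
    intro hh
    obtain ⟨r, hr, hrr⟩ := Finset.mem_image.1 hh
    rw [hmem] at hr
    exact g3 r hr.1 hr.2 hrr
  have inj : Set.InjOn g S := by
    intro r hr r' hr' e
    have hr := (hmem r).1 hr
    have hr' := (hmem r').1 hr'
    by_contra hne
    have hne' : r.1 ≠ r'.1 := fun hh => hne (Subtype.ext hh)
    have a1 : r.1 ⊔ g r = r.1 ⊔ p.1 := exch2 r.2 p.2 (g1 r hr.1 hr.2) (g4 r hr.1 hr.2)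
      (g2 r hr.1 hr.2)
    have a2 : p.1 ⊔ g r = r.1 ⊔ p.1 := by
      rw [exch2 p.2 r.2 (g1 r hr.1 hr.2) (by rw [sup_comm]; exact g4 r hr.1 hr.2)
        (g3 r hr.1 hr.2), sup_comm]
    have a3 : p.1 ⊔ g r' = r'.1 ⊔ p.1 := by
      rw [exch2 p.2 r'.2 (g1 r' hr'.1 hr'.2) (by rw [sup_comm]; exact g4 r' hr'.1 hr'.2)
        (g3 r' hr'.1 hr'.2), sup_comm]
    have a4 : r'.1 ≤ r.1 ⊔ p.1 := by rw [← a2, e, a3]; exact le_sup_left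
    have a5 : r.1 ⊔ r'.1 = r.1 ⊔ p.1 := exch2 r.2 p.2 r'.2 a4 hne'.symm
    apply hpc
    calc p.1 ≤ r.1 ⊔ p.1 := le_sup_right
      _ = r.1 ⊔ r'.1 := a5.symm
      _ ≤ c := sup_le hr.2 hr'.2
  calc nCls hA (Quotient.mk (perspSetoid hA) p) c + 1 = (S.image g).card + 1 := by
        rw [Finset.card_image_of_injOn inj]; rfl
    _ = (insert p.1 (S.image g)).card := (Finset.card_insert_of_notMem hpn).symm
    _ ≤ _ := by
        apply Finset.card_le_card
        intro y hy
        simp only [newAtoms, Finset.mem_filter, Finset.mem_univ, true_and]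
        rcases Finset.mem_insert.1 hy with rfl | hy
        · exact ⟨p.2, hpx, hpc⟩
        · obtain ⟨r, hr, rfl⟩ := Finset.mem_image.1 hy
          rw [hmem] at hr
          refine ⟨g1 r hr.1 hr.2, (g4 r hr.1 hr.2).trans (sup_le (hr.2.trans h.le) hpx), ?_⟩
          intro hh
          apply hpc
          have a1 : r.1 ⊔ g r = r.1 ⊔ p.1 := exch2 r.2 p.2 (g1 r hr.1 hr.2) (g4 r hr.1 hr.2)
            (g2 r hr.1 hr.2)
          calc p.1 ≤ r.1 ⊔ p.1 := le_sup_right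
            _ = r.1 ⊔ g r := a1.symm
            _ ≤ c := sup_le hr.2 hh

theorem nCls_same (hA : AtomSep L) {c x : L} (h : c ⋖ x) (p : {p : L // IsAtom p})
    (hpx : p.1 ≤ x) (hpc : ¬ p.1 ≤ c) :
    nCls hA (Quotient.mk (perspSetoid hA) p) x =
      nCls hA (Quotient.mk (perspSetoid hA) p) c + (newAtoms x c).card := by
  have : (newAtoms x c).card = (Finset.univ.filter (fun q : {p : L // IsAtom p} =>
      q.1 ≤ x ∧ ¬ q.1 ≤ c)).card := by
    rw [← Finset.card_map (Function.Embedding.subtype _)]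
    congr 1
    ext y
    simp [newAtoms]
    tauto
  rw [this, nCls, nCls, ← Finset.card_union_of_disjoint]
  · congr 1
    ext q
    simp only [Finset.mem_filter, Finset.mem_univ, true_and, Finset.mem_union]
    constructor
    · rintro ⟨a, b⟩
      by_cases hq : q.1 ≤ c
      · exact Or.inl ⟨a, hq⟩
      · exact Or.inr ⟨b, hq⟩
    · rintro (⟨a, b⟩ | ⟨a, b⟩)
      · exact ⟨a, b.trans h.le⟩
      · exact ⟨(mk_eq_iff hA q p).2 (persp_new hA h q.2 p.2 a hpx b hpc), a⟩
  · rw [Finset.disjoint_left]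
    intro q hq hq'
    simp only [Finset.mem_filter, Finset.mem_univ, true_and] at hq hq'
    exact hq'.2 hq.2

theorem nCls_other (hA : AtomSep L) {c x : L} (h : c ⋖ x) (p : {p : L // IsAtom p})
    (hpx : p.1 ≤ x) (hpc : ¬ p.1 ≤ c) (k : AtCls hA) (hk : k ≠ Quotient.mk (perspSetoid hA) p) :
    nCls hA k x = nCls hA k c := by
  unfold nCls
  congr 1
  ext q
  simp only [Finset.mem_filter, Finset.mem_univ, true_and]
  constructor
  · rintro ⟨a, b⟩
    refine ⟨a, ?_⟩
    by_contra hq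
    exact hk (a ▸ (mk_eq_iff hA q p).2 (persp_new hA h q.2 p.2 b hpx hq hpc))
  · rintro ⟨a, b⟩
    exact ⟨a, b.trans h.le⟩

/-- The bound attached to one class with `N` atoms. -/
noncomputable def bnd (N : ℕ) : ℝ := if N = 0 then 1 else 8 * N / (N + 3)

theorem bnd_nonneg (N : ℕ) : 0 ≤ bnd N := by
  unfold bnd; split_ifs <;> positivity

theorem bnd_le (N : ℕ) : bnd N ≤ 8 := by
  unfold bnd; split_ifs
  · norm_num
  · rw [div_le_iff₀ (by positivity)]; linarith

theorem bnd_step (N e : ℕ) (h : N + 1 ≤ e) : bnd N * (1 + e) ≤ bnd (N + e) * e := by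
  have he : (N : ℝ) + 1 ≤ e := by exact_mod_cast h
  have hN0 : (0 : ℝ) ≤ N := by positivity
  have : N + e ≠ 0 := by omega
  unfold bnd
  rw [if_neg this]
  split_ifs with hN
  · subst hN
    push_cast
    rw [zero_add, one_mul, div_mul_eq_mul_div, le_div_iff₀ (by linarith)]
    push_cast at he
    nlinarith
  · push_cast
    rw [div_mul_eq_mul_div, div_mul_eq_mul_div, div_le_div_iff₀ (by linarith) (by linarith)]
    have : (N : ℝ) * (1 + e) * (N + e + 3) ≤ (N + e) * e * (N + 3) := by nlinarith
    nlinarith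

theorem ratio_bound (hA : AtomSep L) {m : L → ℝ} (hm : IsMobBot m) : ∀ x : L,
    ∑ y ∈ Finset.univ.filter (fun y => y ≤ x), |m y| ≤ (∏ k : AtCls hA, bnd (nCls hA k x)) * |m x| := by
  intro x
  induction x using WellFoundedLT.induction with
  | _ x ih =>
  by_cases hx : x = ⊥
  · subst hx
    have : ∀ k : AtCls hA, nCls hA k ⊥ = 0 := by
      intro k
      unfold nCls
      rw [Finset.card_eq_zero, Finset.filter_eq_empty_iff]
      rintro q - ⟨-, h⟩
      exact q.2.1 (le_bot_iff.1 h)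
    have e3 : Finset.univ.filter (fun y : L => y ≤ ⊥) = {⊥} := by
      ext y; simp
    rw [e3]
    simp [this, bnd]
  · obtain ⟨c, -, h⟩ := exists_le_covBy_of_lt (bot_lt_iff_ne_bot.2 hx)
    obtain ⟨p, hp, hpx, hpc⟩ := hA _ _ h.lt.not_ge
    have i1 := ih c h.lt
    have i2 := card_new_ge hA h ⟨p, hp⟩ hpx hpc
    have i3 := nCls_same hA h ⟨p, hp⟩ hpx hpc
    have i4 := nCls_other hA h ⟨p, hp⟩ hpx hpc
    rw [abs_sum_cov hm h, mob_cov hm x c h, abs_mul, abs_neg, Nat.abs_cast]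
    set k0 := Quotient.mk (perspSetoid hA) ⟨p, hp⟩ with hk0
    rw [← Finset.mul_prod_erase Finset.univ _ (Finset.mem_univ k0)] at i1 ⊢
    rw [i3]
    have i5 : ∏ k ∈ Finset.univ.erase k0, bnd (nCls hA k x) =
        ∏ k ∈ Finset.univ.erase k0, bnd (nCls hA k c) := by
      apply Finset.prod_congr rfl
      intro k hk
      rw [i4 k (Finset.ne_of_mem_erase hk)]
    rw [i5]
    set P := ∏ k ∈ Finset.univ.erase k0, bnd (nCls hA k c)
    have hP : 0 ≤ P := Finset.prod_nonneg fun k _ => bnd_nonneg _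
    have i6 := bnd_step _ _ i2
    calc (1 + ((newAtoms x c).card : ℝ)) * ∑ y ∈ Finset.univ.filter (fun y => y ≤ c), |m y|
        ≤ (1 + ((newAtoms x c).card : ℝ)) * (bnd (nCls hA k0 c) * P * |m c|) := by gcongr
      _ = (bnd (nCls hA k0 c) * (1 + ((newAtoms x c).card : ℝ))) * (P * |m c|) := by ring
      _ ≤ (bnd (nCls hA k0 c + (newAtoms x c).card) * ((newAtoms x c).card : ℝ)) * (P * |m c|) := by
          gcongr
      _ = _ := by ring

/-- The join of all atoms with class in `A`. -/
noncomputable def clsSup (hA : AtomSep L) (A : Set (AtCls hA)) : L :=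
  (Finset.univ.filter (fun p : {p : L // IsAtom p} => Quotient.mk (perspSetoid hA) p ∈ A)).sup
    (fun p => p.1)

theorem le_finset_sup (hA : AtomSep L) (S : Finset {p : L // IsAtom p}) :
    ∀ q : {p : L // IsAtom p}, q.1 ≤ S.sup (fun p => p.1) → ∃ p ∈ S, Persp p.1 q.1 := by
  induction S using Finset.induction_on with
  | empty => intro q hq; exact absurd (le_bot_iff.1 hq) q.2.1
  | insert p S hp ih =>
    intro q hq
    rw [Finset.sup_insert] at hq
    by_cases h1 : q.1 ≤ p.1
    · exact ⟨p, Finset.mem_insert_self _ _, Or.inl (atom_le_atom q.2 p.2 h1).symm⟩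
    by_cases h2 : q.1 ≤ S.sup (fun p => p.1)
    · obtain ⟨r, hr, hh⟩ := ih q h2
      exact ⟨r, Finset.mem_insert_of_mem hr, hh⟩
    obtain ⟨r, s, hr, hs, hrp, hsS, hrs⟩ := projLemma hA q.2 hq h1 h2
    obtain ⟨t, ht, hh⟩ := ih ⟨s, hs⟩ hsS
    refine ⟨t, Finset.mem_insert_of_mem ht, hh.trans hA t.2 hs q.2 (Or.inr ⟨r, hr, ?_, ?_, ?_⟩)⟩
    · rintro rfl
      rw [sup_idem] at hrs
      exact h1 (hrs.trans hrp)
    · intro hh; exact h1 (hh ▸ hrp)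
    · rw [exch2 hs hr q.2 (by rwa [sup_comm]) (fun hh => h2 (hh ▸ hsS))]
      exact le_sup_right

theorem le_clsSup (hA : AtomSep L) (A : Set (AtCls hA)) (q : {p : L // IsAtom p}) :
    q.1 ≤ clsSup hA A ↔ Quotient.mk (perspSetoid hA) q ∈ A := by
  constructor
  · intro h
    obtain ⟨p, hp, hh⟩ := le_finset_sup hA _ q h
    rw [← mk_eq_iff hA] at hh
    rw [← hh]
    simpa using hp
  · intro h
    apply Finset.le_sup (f := fun p : {p : L // IsAtom p} => p.1)
    simpa using h

theorem clsSup_neutral (hA : AtomSep L) (A : Set (AtCls hA)) (a b : L) :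
    clsSup hA A ⊓ (a ⊔ b) = (clsSup hA A ⊓ a) ⊔ (clsSup hA A ⊓ b) := by
  apply le_antisymm
  · by_contra hh
    obtain ⟨q, hq, h1, h2⟩ := hA _ _ hh
    have hqt := h1.trans inf_le_left
    have hqab := h1.trans inf_le_right
    have hqa : ¬ q ≤ a := fun h => h2 ((le_inf hqt h).trans le_sup_left)
    have hqb : ¬ q ≤ b := fun h => h2 ((le_inf hqt h).trans le_sup_right)
    obtain ⟨r, s, hr, hs, hra, hsb, hrs⟩ := projLemma hA hq hqab hqa hqb
    have hrq : r ≠ q := fun h => hqa (h ▸ hra)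
    have hsq : s ≠ q := fun h => hqb (h ▸ hsb)
    have hrs' : r ≠ s := by
      rintro rfl
      rw [sup_idem] at hrs
      exact hqa (hrs.trans hra)
    have hA1 := (le_clsSup hA A ⟨q, hq⟩).1 hqt
    have e1 : s ⊔ q = s ⊔ r := exch2 hs hr hq (by rwa [sup_comm]) hsq.symm
    have e2 : r ⊔ q = r ⊔ s := exch2 hr hs hq hrs hrq.symm
    have p1 : Persp r q := Or.inr ⟨s, hs, hrs'.symm, hsq, by rw [e2]; exact le_sup_right⟩
    have p2 : Persp s q := Or.inr ⟨r, hr, hrs', hrq, by rw [e1]; exact le_sup_right⟩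
    have q1 := (mk_eq_iff hA ⟨r, hr⟩ ⟨q, hq⟩).2 p1
    have q2 := (mk_eq_iff hA ⟨s, hs⟩ ⟨q, hq⟩).2 p2
    have r1 : r ≤ clsSup hA A := (le_clsSup hA A ⟨r, hr⟩).2 (q1 ▸ hA1)
    have r2 : s ≤ clsSup hA A := (le_clsSup hA A ⟨s, hs⟩).2 (q2 ▸ hA1)
    exact h2 (hrs.trans (sup_le_sup (le_inf r1 hra) (le_inf r2 hsb)))
  · exact sup_le (inf_le_inf_left _ le_sup_left) (inf_le_inf_left _ le_sup_right)

theorem clsSup_injective (hA : AtomSep L) : Function.Injective (clsSup hA) := by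
  intro A B h
  ext k
  obtain ⟨q, rfl⟩ := Quotient.exists_rep k
  rw [← le_clsSup, ← le_clsSup, h]

theorem main_bound (hA : AtomSep L) {m : L → ℝ} (hm : IsMobBot m) (x : L) (hx : ∀ y, y ≤ x) :
    ∑ y : L, |m y| ≤
      ((Nat.card {t : L // ∀ a b : L, t ⊓ (a ⊔ b) = (t ⊓ a) ⊔ (t ⊓ b)} : ℕ) : ℝ) ^ 3 * |m x| := by
  have h1 := ratio_bound hA hm x
  have e : Finset.univ.filter (fun y => y ≤ x) = Finset.univ := by
    ext y; simp [hx]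
  rw [e] at h1
  refine h1.trans ?_
  gcongr
  have h2 : ∏ k : AtCls hA, bnd (nCls hA k x) ≤ 8 ^ (Fintype.card (AtCls hA)) := by
    calc ∏ k : AtCls hA, bnd (nCls hA k x) ≤ ∏ k : AtCls hA, (8 : ℝ) :=
          Finset.prod_le_prod (fun k _ => bnd_nonneg _) (fun k _ => bnd_le _)
      _ = _ := by simp
  have h3 : 2 ^ (Fintype.card (AtCls hA)) ≤
      Nat.card {t : L // ∀ a b : L, t ⊓ (a ⊔ b) = (t ⊓ a) ⊔ (t ⊓ b)} := by
    have := Nat.card_le_card_of_injective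
      (fun A : Set (AtCls hA) => (⟨clsSup hA A, clsSup_neutral hA A⟩ :
        {t : L // ∀ a b : L, t ⊓ (a ⊔ b) = (t ⊓ a) ⊔ (t ⊓ b)}))
      (fun A B h => clsSup_injective hA (congrArg Subtype.val h))
    rwa [Nat.card_eq_fintype_card, Fintype.card_set] at this
  have h4 : ((2 : ℝ) ^ (Fintype.card (AtCls hA))) ≤
      (Nat.card {t : L // ∀ a b : L, t ⊓ (a ⊔ b) = (t ⊓ a) ⊔ (t ⊓ b)} : ℕ) := by exact_mod_cast h3
  calc ∏ k : AtCls hA, bnd (nCls hA k x) ≤ 8 ^ (Fintype.card (AtCls hA)) := h2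
    _ = ((2 : ℝ) ^ (Fintype.card (AtCls hA))) ^ 3 := by
        rw [← pow_mul, mul_comm, pow_mul]; norm_num
    _ ≤ _ := by gcongr

theorem main_bound_Iic {m : L → ℝ} (hm : IsMobBot m) (K : L) (hK : JA K) :
    ∑ y ∈ Finset.univ.filter (fun y => y ≤ K), |m y| ≤
      ((Nat.card {t : L // t ≤ K ∧ ∀ a b : L, a ≤ K → b ≤ K →
        t ⊓ (a ⊔ b) = (t ⊓ a) ⊔ (t ⊓ b)} : ℕ) : ℝ) ^ 3 * |m K| := by
  have hA : AtomSep (Set.Iic K) := by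
    intro y c hyc
    obtain ⟨p, hp, h1, h2⟩ := JA_atom hK (y := y.1) (c := c.1) y.2 hyc
    exact ⟨⟨p, h1.trans y.2⟩, hp.Iic _, h1, h2⟩
  have key : ∀ (f : L → ℝ) (x : L), x ≤ K →
      ∑ y ∈ Finset.univ.filter (fun y : Set.Iic K => y.1 ≤ x), f y.1 =
      ∑ y ∈ Finset.univ.filter (fun y => y ≤ x), f y := by
    intro f x hx
    refine Finset.sum_bij (fun y _ => y.1) ?_ ?_ ?_ ?_
    · intro y hy; simpa using hy
    · intro y _ z _ h; exact Subtype.ext h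
    · intro y hy
      simp only [Finset.mem_filter, Finset.mem_univ, true_and] at hy
      exact ⟨⟨y, hy.trans hx⟩, by simpa using hy, rfl⟩
    · intro y hy; rfl
  have hm' : IsMobBot (fun y : Set.Iic K => m y.1) := by
    refine ⟨hm.1, ?_⟩
    intro x hx
    have h1 := hm.2 x.1 (fun h => hx (Subtype.ext h))
    rw [← key m x.1 x.2] at h1
    exact h1
  have h2 := main_bound hA hm' ⟨K, le_rfl⟩ (fun y => y.2)
  have h3 := key (fun y => |m y|) K le_rfl
  rw [← h3]
  have e : Finset.univ.filter (fun y : Set.Iic K => y.1 ≤ K) = Finset.univ :=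
    Finset.filter_true_of_mem (fun y _ => y.2)
  rw [e]
  refine h2.trans ?_
  gcongr
  have : Nat.card {t : Set.Iic K // ∀ a b : Set.Iic K, t ⊓ (a ⊔ b) = (t ⊓ a) ⊔ (t ⊓ b)} ≤
      Nat.card {t : L // t ≤ K ∧ ∀ a b : L, a ≤ K → b ≤ K → t ⊓ (a ⊔ b) = (t ⊓ a) ⊔ (t ⊓ b)} := by
    apply Nat.card_le_card_of_injective
      (fun t => ⟨t.1.1, t.1.2, fun a b ha hb =>
        congrArg Subtype.val (t.2 ⟨a, ha⟩ ⟨b, hb⟩)⟩)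
    intro t s h
    exact Subtype.ext (Subtype.ext (congrArg (fun z => z.1) h))
  exact_mod_cast this

end LatticePart

theorem mobLeft {P : Type*} [PartialOrder P] [OrderTop P] [Fintype P] (mu : P → P → ℝ)
    (h1 : ∀ x, mu x x = 1) (h2 : ∀ x y, x < y → ∑ᶠ z ∈ Set.Icc x y, mu x z = 0) :
    ∀ x, x ≠ ⊤ → ∑ z ∈ Finset.univ.filter (fun z => x ≤ z), mu z ⊤ = 0 := by
  letI : LocallyFiniteOrder P := Fintype.toLocallyFiniteOrder
  have conv : ∀ x y (f : P → ℝ), ∑ᶠ z ∈ Set.Icc x y, f z = ∑ z ∈ Finset.Icc x y, f z := by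
    intro x y f
    rw [← Finset.coe_Icc, finsum_mem_coe_finset]
  have e : ∀ x y, x ≤ y → mu x y = IncidenceAlgebra.mu ℝ x y := by
    intro x y
    induction y using WellFoundedLT.induction with
    | _ y ih =>
    intro hxy
    rcases hxy.eq_or_lt with rfl | hlt
    · rw [h1, IncidenceAlgebra.mu_self]
    · have a := h2 x y hlt
      rw [conv, Finset.Icc_eq_cons_Ico hxy, Finset.sum_cons] at a
      rw [IncidenceAlgebra.mu_eq_neg_sum_Ico_of_ne hlt.ne]
      have : ∑ z ∈ Finset.Ico x y, mu x z = ∑ z ∈ Finset.Ico x y, IncidenceAlgebra.mu ℝ x z := by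
        apply Finset.sum_congr rfl
        intro z hz
        rw [Finset.mem_Ico] at hz
        exact ih z hz.2 hz.1
      linarith
  intro x hx
  have b := IncidenceAlgebra.sum_Icc_mu_left (𝕜 := ℝ) x (⊤ : P)
  rw [if_neg hx] at b
  rw [← b]
  have : Finset.univ.filter (fun z => x ≤ z) = Finset.Icc x ⊤ := by
    ext z; simp
  rw [this]
  apply Finset.sum_congr rfl
  intro z hz
  exact e z ⊤ le_top

variable {C : Type u} [SmallCategory C]

theorem IsDiamond.isLUB_qSup (hC : IsDiamond C) {G : C} (a b : Quotients G) :
    IsLUB {a, b} (qSup a b) := by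
  unfold qSup
  rw [dif_pos (hC.lub G a b)]
  exact (hC.lub G a b).choose_spec

theorem IsDiamond.isGLB_qInf (hC : IsDiamond C) {G : C} (a b : Quotients G) :
    IsGLB {a, b} (qInf a b) := by
  unfold qInf
  rw [dif_pos (hC.glb G a b)]
  exact (hC.glb G a b).choose_spec

/-- The lattice structure on quotients. -/
@[reducible] noncomputable def qLat (hC : IsDiamond C) (G : C) : Lattice (Quotients G) where
  sup := qSup
  inf := qInf
  le_sup_left a b := (hC.isLUB_qSup a b).1 (by simp)
  le_sup_right a b := (hC.isLUB_qSup a b).1 (by simp)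
  sup_le a b c h1 h2 := (hC.isLUB_qSup a b).2 (by simp [h1, h2])
  inf_le_left a b := (hC.isGLB_qInf a b).1 (by simp)
  inf_le_right a b := (hC.isGLB_qInf a b).1 (by simp)
  le_inf a b c h1 h2 := (hC.isGLB_qInf b c).2 (by simp [h1, h2])

theorem qMod (hC : IsDiamond C) (G : C) :
    letI := qLat hC G
    IsModularLattice (Quotients G) := by
  letI := qLat hC G
  refine ⟨?_⟩
  intro x y z h
  exact (hC.modular G x z y h).ge

/-- The semisimplicity condition used in the proof: `K` is the meet of the coatoms above it. -/
def SS {G : C} (K : Quotients G) : Prop :=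
  ∀ c : Quotients G, (∀ h : Quotients G, h ⋖ ⊤ → K ≤ h → c ≤ h) → c ≤ K

theorem SS_iff (hC : IsDiamond C) {G : C} (K : Quotients G) :
    letI := qLat hC G
    SS K ↔ JA (OrderDual.toDual K) := by
  letI := qLat hC G
  constructor
  · intro h c hc
    refine h (OrderDual.ofDual c) ?_
    intro p hp hK
    exact hc (OrderDual.toDual p) (covBy_top_iff.1 hp).dual hK
  · intro h c hc
    refine h (OrderDual.toDual c) ?_
    intro p hp hK
    exact hc (OrderDual.ofDual p) (covBy_top_iff.2 hp.dual) hK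

theorem isMobBot_dual (hC : IsDiamond C) {mob : ∀ G : C, Quotients G → Quotients G → ℝ}
    (hmob : IsMobiusFamily mob) (G : C) [Fintype (Quotients G)ᵒᵈ] :
    letI := qLat hC G
    IsMobBot (L := (Quotients G)ᵒᵈ) (fun y => mob G (OrderDual.ofDual y) ⊤) := by
  letI := qLat hC G
  letI : Fintype (Quotients G) := inferInstanceAs (Fintype (Quotients G)ᵒᵈ)
  refine ⟨(hmob G).1 ⊤, ?_⟩
  intro x hx
  exact mobLeft (mob G) (hmob G).1 (hmob G).2 (OrderDual.ofDual x) hx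

theorem SS_of_mob_ne_zero (hC : IsDiamond C) {mob : ∀ G : C, Quotients G → Quotients G → ℝ}
    (hmob : IsMobiusFamily mob) {G : C} (a : Quotients G) (h : mob G a ⊤ ≠ 0) : SS a := by
  letI := qLat hC G
  haveI := qMod hC G
  haveI := hC.quotFinite G
  letI : Fintype (Quotients G)ᵒᵈ := @Fintype.ofFinite _ (hC.quotFinite G)
  rw [SS_iff hC]
  exact JA_of_mob_ne_zero (isMobBot_dual hC hmob G) h

theorem SS_qInf (hC : IsDiamond C) {G : C} {a b : Quotients G} (ha : SS a) (hb : SS b) :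
    SS (qInf a b) := by
  letI := qLat hC G
  haveI := qMod hC G
  letI : Fintype (Quotients G)ᵒᵈ := @Fintype.ofFinite _ (hC.quotFinite G)
  rw [SS_iff hC] at ha hb ⊢
  exact JA_sup ha hb

theorem bound_Z (hC : IsDiamond C) {mob : ∀ G : C, Quotients G → Quotients G → ℝ}
    (hmob : IsMobiusFamily mob) {G F : C} (σ : G ⟶ F) (h : Epi σ) (hss : SS (quotOf σ h))
    [Fintype (Quotients G)] :
    ∑ a ∈ Finset.univ.filter (fun a : Quotients G => quotOf σ h ≤ a), |mob G a ⊤| ≤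
      (Zfn σ h : ℝ) ^ 3 * |mob G (quotOf σ h) ⊤| := by
  letI := qLat hC G
  haveI := qMod hC G
  letI : Fintype (Quotients G)ᵒᵈ := inferInstanceAs (Fintype (Quotients G))
  rw [SS_iff hC] at hss
  exact main_bound_Iic (isMobBot_dual hC hmob G) _ hss

/-- The canonical projection onto the underlying object of a quotient class. -/
noncomputable def pr {G : C} (a : Quotients G) : G ⟶ qObj a := (Subobject.arrow a).unop

theorem pr_epi {G : C} (a : Quotients G) : Epi (pr a) := by
  unfold pr
  exact unop_epi_of_mono (Subobject.arrow a)

theorem quotOf_pr {G : C} (a : Quotients G) : quotOf (pr a) (pr_epi a) = a := by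
  unfold quotOf pr
  exact Subobject.mk_arrow a

theorem quotOf_le_iff {G F F' : C} {π : G ⟶ F} {π' : G ⟶ F'} (h : Epi π) (h' : Epi π') :
    quotOf π h ≤ quotOf π' h' ↔ ∃ ρ : F' ⟶ F, π' ≫ ρ = π := by
  haveI := h; haveI := h'
  unfold quotOf
  constructor
  · intro hle
    refine ⟨(Subobject.ofMkLEMk _ _ hle).unop, ?_⟩
    have := Subobject.ofMkLEMk_comp hle
    have h2 := congrArg Quiver.Hom.unop this
    exact h2
  · rintro ⟨ρ, hρ⟩
    refine Subobject.mk_le_mk_of_comm ρ.op ?_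
    rw [← op_comp, hρ]

theorem quotOf_eq_iff {G F F' : C} {π : G ⟶ F} {π' : G ⟶ F'} (h : Epi π) (h' : Epi π') :
    quotOf π h = quotOf π' h' ↔ ∃ i : F' ≅ F, π' ≫ i.hom = π := by
  haveI := h; haveI := h'
  constructor
  · intro he
    obtain ⟨r, hr⟩ := (quotOf_le_iff h h').1 he.le
    obtain ⟨s, hs⟩ := (quotOf_le_iff h' h).1 he.ge
    refine ⟨⟨r, s, ?_, ?_⟩, hr⟩
    · rw [← cancel_epi π', ← Category.assoc, hr, hs, Category.comp_id]
    · rw [← cancel_epi π, ← Category.assoc, hs, hr, Category.comp_id]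
  · rintro ⟨i, hi⟩
    apply le_antisymm
    · exact (quotOf_le_iff h h').2 ⟨i.hom, hi⟩
    · exact (quotOf_le_iff h' h).2 ⟨i.inv, by rw [← hi]; simp⟩

theorem qObj_quotOf {G F : C} (π : G ⟶ F) (h : Epi π) : Nonempty (qObj (quotOf π h) ≅ F) := by
  obtain ⟨i, -⟩ := (quotOf_eq_iff (pr_epi _) h).1 (quotOf_pr (quotOf π h))
  exact ⟨i.symm⟩

theorem quotOf_id (G : C) (h : Epi (𝟙 G)) : quotOf (𝟙 G) h = ⊤ := by
  unfold quotOf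
  haveI := h
  apply le_antisymm le_top
  have := quotOf_pr (⊤ : Quotients G)
  conv_lhs => rw [← this]
  exact (quotOf_le_iff (pr_epi _) h).2 ⟨pr _, by simp⟩

theorem quotOf_eq_top_iff {G F : C} (π : G ⟶ F) (h : Epi π) : quotOf π h = ⊤ ↔ IsIso π := by
  rw [← quotOf_id G inferInstance, quotOf_eq_iff]
  constructor
  · rintro ⟨i, hi⟩
    rw [← hi]; infer_instance
  · intro hi
    exact ⟨asIso π, by simp⟩

theorem epi_of_comp {G F E : C} {π : G ⟶ F} {ρ : F ⟶ E} (h : Epi (π ≫ ρ)) : Epi ρ :=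
  haveI := h
  epi_of_epi π ρ

/-- Inflation of quotients along an epimorphism. -/
noncomputable def pull {G F : C} (π : G ⟶ F) (h : Epi π) (b : Quotients F) : Quotients G :=
  quotOf (π ≫ pr b) (epiComp h (pr_epi b))

theorem pull_quotOf {G F E : C} {π : G ⟶ F} (h : Epi π) {ρ : F ⟶ E} (h2 : Epi ρ) :
    pull π h (quotOf ρ h2) = quotOf (π ≫ ρ) (epiComp h h2) := by
  obtain ⟨i, hi⟩ := (quotOf_eq_iff (pr_epi _) h2).1 (quotOf_pr (quotOf ρ h2))
  unfold pull
  rw [quotOf_eq_iff]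
  exact ⟨i, by rw [Category.assoc, hi]⟩

theorem pull_le_iff {G F : C} {π : G ⟶ F} (h : Epi π) {b c : Quotients F} :
    pull π h b ≤ pull π h c ↔ b ≤ c := by
  haveI := h
  unfold pull
  conv_rhs => rw [← quotOf_pr b, ← quotOf_pr c]
  rw [quotOf_le_iff, quotOf_le_iff]
  constructor
  · rintro ⟨r, hr⟩
    exact ⟨r, by rw [← cancel_epi π, ← hr, Category.assoc]⟩
  · rintro ⟨r, hr⟩
    exact ⟨r, by rw [← hr, Category.assoc]⟩

theorem pull_inj {G F : C} {π : G ⟶ F} (h : Epi π) {b c : Quotients F}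
    (e : pull π h b = pull π h c) : b = c :=
  le_antisymm ((pull_le_iff h).1 e.le) ((pull_le_iff h).1 e.ge)

theorem pull_top {G F : C} {π : G ⟶ F} (h : Epi π) : pull π h ⊤ = quotOf π h := by
  rw [← quotOf_id F inferInstance, pull_quotOf]
  simp

theorem exists_pull {G F : C} {π : G ⟶ F} (h : Epi π) {a : Quotients G} (ha : a ≤ quotOf π h) :
    ∃ b, pull π h b = a := by
  rw [← quotOf_pr a, quotOf_le_iff] at ha
  obtain ⟨r, hr⟩ := ha
  have hr' : Epi r := epi_of_comp (π := π) (by rw [hr]; exact pr_epi a)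
  refine ⟨quotOf r hr', ?_⟩
  rw [pull_quotOf]
  conv_rhs => rw [← quotOf_pr a]
  rw [quotOf_eq_iff]
  exact ⟨Iso.refl _, by simp [hr]⟩

theorem qObj_pull {G F : C} {π : G ⟶ F} (h : Epi π) (b : Quotients F) :
    Nonempty (qObj (pull π h b) ≅ qObj b) := qObj_quotOf _ _

theorem qSup_eq (hC : IsDiamond C) {G : C} {a b c : Quotients G} (h : IsLUB {a, b} c) :
    qSup a b = c := (hC.isLUB_qSup a b).unique h

theorem qInf_eq (hC : IsDiamond C) {G : C} {a b c : Quotients G} (h : IsGLB {a, b} c) :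
    qInf a b = c := (hC.isGLB_qInf a b).unique h

theorem pull_qSup (hC : IsDiamond C) {G F : C} {π : G ⟶ F} (h : Epi π) (b c : Quotients F) :
    pull π h (qSup b c) = qSup (pull π h b) (pull π h c) := by
  letI := qLat hC G
  letI := qLat hC F
  change pull π h (b ⊔ c) = pull π h b ⊔ pull π h c
  apply le_antisymm
  · obtain ⟨d, hd⟩ := exists_pull h (a := pull π h b ⊔ pull π h c)
      (sup_le (by rw [← pull_top, pull_le_iff]; exact le_top)
        (by rw [← pull_top, pull_le_iff]; exact le_top))
    rw [← hd, pull_le_iff]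
    apply sup_le
    · rw [← pull_le_iff h, hd]; exact le_sup_left
    · rw [← pull_le_iff h, hd]; exact le_sup_right
  · apply sup_le
    · rw [pull_le_iff]; exact le_sup_left
    · rw [pull_le_iff]; exact le_sup_right

theorem pull_qInf (hC : IsDiamond C) {G F : C} {π : G ⟶ F} (h : Epi π) (b c : Quotients F) :
    pull π h (qInf b c) = qInf (pull π h b) (pull π h c) := by
  letI := qLat hC G
  letI := qLat hC F
  change pull π h (b ⊓ c) = pull π h b ⊓ pull π h c
  apply le_antisymm
  · apply le_inf
    · rw [pull_le_iff]; exact inf_le_left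
    · rw [pull_le_iff]; exact inf_le_right
  · obtain ⟨d, hd⟩ := exists_pull h (a := pull π h b ⊓ pull π h c)
      (inf_le_left.trans (by rw [← pull_top, pull_le_iff]; exact le_top))
    rw [← hd, pull_le_iff]
    apply le_inf
    · rw [← pull_le_iff h, hd]; exact inf_le_left
    · rw [← pull_le_iff h, hd]; exact inf_le_right

theorem IsFormation.iso {W : Set C} (hW : IsFormation W) {G F : C} (h : G ∈ W) (i : G ≅ F) :
    F ∈ W := hW.1 G h F i.hom inferInstance

theorem IsFormation.of_le {W : Set C} (hW : IsFormation W) {G : C} {a b : Quotients G}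
    (h : qObj b ∈ W) (hab : a ≤ b) : qObj a ∈ W := by
  rw [← quotOf_pr a, ← quotOf_pr b, quotOf_le_iff] at hab
  obtain ⟨r, hr⟩ := hab
  exact hW.1 _ h _ r (epi_of_comp (π := pr b) (by rw [hr]; exact pr_epi a))

theorem IsFormation.qSup_mem {W : Set C} (hC : IsDiamond C) (hW : IsFormation W) {G : C}
    {a b : Quotients G} (ha : qObj a ∈ W) (hb : qObj b ∈ W) : qObj (qSup a b) ∈ W :=
  hW.2.1 G a b ha hb (hC.lub G a b)

theorem IsFormation.exists_mem {W : Set C} (hC : IsDiamond C) (hW : IsFormation W) (G : C) :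
    ∃ a : Quotients G, qObj a ∈ W := by
  letI := qLat hC G
  haveI := hC.quotFinite G
  obtain ⟨b, hb⟩ := (Set.toFinite (Set.univ : Set (Quotients G))).exists_minimal ⟨⊤, trivial⟩
  refine ⟨b, hW.2.2 _ ⟨?_⟩⟩
  have key : ∀ x : Quotients (qObj b), pull (pr b) (pr_epi b) x = b := by
    intro x
    have : pull (pr b) (pr_epi b) x ≤ b := by
      conv_rhs => rw [← quotOf_pr b, ← pull_top]
      rw [pull_le_iff]; exact le_top
    exact le_antisymm this (hb.2 trivial this)
  intro x y
  exact pull_inj (pr_epi b) ((key x).trans (key y).symm)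

theorem wQuot_spec {W : Set C} (hC : IsDiamond C) (hW : IsFormation W) (G : C) :
    IsGreatest {a : Quotients G | qObj a ∈ W} (wQuot W G) := by
  letI := qLat hC G
  haveI := hC.quotFinite G
  obtain ⟨m, hm⟩ := (Set.toFinite {a : Quotients G | qObj a ∈ W}).exists_maximal
    (hW.exists_mem hC G)
  have hg : IsGreatest {a : Quotients G | qObj a ∈ W} m := by
    refine ⟨hm.1, fun a ha => ?_⟩
    have : qObj (qSup m a) ∈ W := hW.qSup_mem hC hm.1 ha
    exact (le_sup_right : a ≤ m ⊔ a).trans (hm.2 this le_sup_left)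
  have hl : ∃ c, IsLUB {a : Quotients G | qObj a ∈ W} c := ⟨m, hg.isLUB⟩
  have : wQuot W G = m := by
    unfold wQuot qsSup
    rw [dif_pos hl]
    exact hl.choose_spec.unique hg.isLUB
  rw [this]; exact hg

theorem pull_wQuot {W : Set C} (hC : IsDiamond C) (hW : IsFormation W) {G F : C} {π : G ⟶ F}
    (h : Epi π) : pull π h (wQuot W F) = qInf (quotOf π h) (wQuot W G) := by
  letI := qLat hC G
  change _ = quotOf π h ⊓ wQuot W G
  apply le_antisymm
  · apply le_inf
    · rw [← pull_top, pull_le_iff]; exact le_top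
    · apply (wQuot_spec hC hW G).2
      exact hW.iso (wQuot_spec hC hW F).1 (qObj_pull h _).some.symm
  · obtain ⟨d, hd⟩ := exists_pull h (a := quotOf π h ⊓ wQuot W G) inf_le_left
    rw [← hd, pull_le_iff]
    apply (wQuot_spec hC hW F).2
    refine hW.iso ?_ (qObj_pull h d).some
    rw [hd]
    exact hW.of_le (wQuot_spec hC hW G).1 inf_le_right

/-- Complementedness of the interval `[G^{W̄}, G^W]`. -/
theorem compl_interval {Wb W : Set C} (hC : IsDiamond C) (hWbF : IsFormation Wb)
    (hWF : IsFormation W) (hsub : Wb ⊆ W) (hss : ∀ G ∈ W, IntervalComplTop (wQuot Wb G)) (G : C) :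
    wQuot Wb G ≤ wQuot W G ∧ ∀ X, wQuot Wb G ≤ X → X ≤ wQuot W G →
      ∃ Y, wQuot Wb G ≤ Y ∧ Y ≤ wQuot W G ∧ qSup X Y = wQuot W G ∧ qInf X Y = wQuot Wb G := by
  have h1 : wQuot Wb G ≤ wQuot W G := (wQuot_spec hC hWF G).2 (hsub (wQuot_spec hC hWbF G).1)
  refine ⟨h1, ?_⟩
  intro X hX1 hX2
  set w := wQuot W G with hw
  have hp : quotOf (pr w) (pr_epi w) = w := quotOf_pr w
  have e : pull (pr w) (pr_epi w) (wQuot Wb (qObj w)) = wQuot Wb G := by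
    rw [pull_wQuot hC hWbF, hp]
    letI := qLat hC G
    change w ⊓ wQuot Wb G = _
    exact inf_eq_right.2 h1
  obtain ⟨x, hx⟩ := exists_pull (pr_epi w) (a := X) (by rw [hp]; exact hX2)
  obtain ⟨y, hy1, hy2, hy3⟩ := hss (qObj w) (wQuot_spec hC hWF G).1 x
    (by rw [← pull_le_iff (pr_epi w), e, hx]; exact hX1)
  refine ⟨pull (pr w) (pr_epi w) y, ?_, ?_, ?_, ?_⟩
  · rw [← e, pull_le_iff]; exact hy1
  · conv_rhs => rw [← hp, ← pull_top]
    rw [pull_le_iff]; exact le_top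
  · rw [← hx, ← pull_qSup hC, hy2, pull_top, hp]
  · rw [← hx, ← pull_qInf hC, hy3, e]

theorem SS_join {Wb W : Set C} (hC : IsDiamond C) (hWbF : IsFormation Wb)
    (hWF : IsFormation W) (hsub : Wb ⊆ W) (hss : ∀ G ∈ W, IntervalComplTop (wQuot Wb G)) {G : C}
    (e : Quotients G) (he : qSup (wQuot W G) e = ⊤) : SS (qSup (wQuot Wb G) e) := by
  obtain ⟨h1, hc⟩ := compl_interval hC hWbF hWF hsub hss G
  letI := qLat hC G
  haveI := qMod hC G
  haveI := hC.quotFinite G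
  have hc' : ∀ X, wQuot Wb G ≤ X → X ≤ wQuot W G →
      ∃ Y, wQuot Wb G ≤ Y ∧ Y ≤ wQuot W G ∧ X ⊔ Y = wQuot W G ∧ X ⊓ Y = wQuot Wb G := hc
  change wQuot W G ⊔ e = ⊤ at he
  change SS (wQuot Wb G ⊔ e)
  generalize wQuot W G = w at *
  generalize wQuot Wb G = v at *
  intro c0 hc0
  suffices H : c0 ⊔ (v ⊔ e) ≤ v ⊔ e from le_sup_left.trans H
  have hcc : ∀ h, h ⋖ ⊤ → v ⊔ e ≤ h → c0 ⊔ (v ⊔ e) ≤ h := fun h hh1 hh2 =>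
    sup_le (hc0 h hh1 hh2) hh2
  have hAc : v ⊔ e ≤ c0 ⊔ (v ⊔ e) := le_sup_right
  generalize c0 ⊔ (v ⊔ e) = c at *
  have hvc : v ≤ c := le_sup_left.trans hAc
  have hec : e ≤ c := le_sup_right.trans hAc
  obtain ⟨Y, hY1, hY2, hY3, hY4⟩ := hc' (c ⊓ w) (le_inf hvc h1) inf_le_right
  have s1 : c ⊔ (Y ⊔ e) = ⊤ := by
    rw [eq_top_iff, ← he]
    apply sup_le
    · rw [← hY3]
      exact sup_le (inf_le_left.trans le_sup_left) (le_sup_left.trans le_sup_right)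
    · exact hec.trans le_sup_left
  have s2 : c ⊓ (Y ⊔ e) = v ⊔ e := by
    have : c ⊓ Y = v := by
      rw [← hY4, inf_assoc, inf_eq_right.2 hY2]
    rw [← inf_sup_assoc_of_le Y hec, this]
  by_cases hT : Y ⊔ e = ⊤
  · rw [hT, inf_top_eq] at s2
    exact s2.le
  · exfalso
    obtain ⟨h, hh1, hh2⟩ := (eq_top_or_exists_le_coatom (Y ⊔ e)).resolve_left hT
    have hch := hcc h (covBy_top_iff.2 hh1) ((sup_le_sup_right hY1 e).trans hh2)
    exact hh1.1 (top_le_iff.1 (s1 ▸ sup_le hch hh2))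

theorem cls_eq_of_iso {X : IsoCls C} {F : C} (i : X.out ≅ F) : X = cls F := by
  rw [← Quotient.out_eq X]
  exact Quotient.sound ⟨i⟩

theorem cls_out_iso (F : C) : Nonempty ((cls F).out ≅ F) :=
  Quotient.exact (Quotient.out_eq (cls F))

theorem finite_above (hC : IsDiamond C) {Wt : Set C} (hWtn : Narrow Wt)
    (hWtF : IsFormation Wt) (Hb : C) (n : ℕ) :
    {X : IsoCls C | X.out ∈ Wt ∧ ∃ π : Epis X.out Hb,
      Nat.card {a : Quotients X.out // quotOf π.1 π.2 ≤ a} ≤ n}.Finite := by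
  induction n with
  | zero =>
    convert Set.finite_empty
    rw [Set.eq_empty_iff_forall_notMem]
    rintro X ⟨-, π, h⟩
    haveI := hC.quotFinite X.out
    haveI : Nonempty {a : Quotients X.out // quotOf π.1 π.2 ≤ a} := ⟨⟨⊤, le_top⟩⟩
    have := Nat.card_pos (α := {a : Quotients X.out // quotOf π.1 π.2 ≤ a})
    omega
  | succ n ih =>
    have hfin := (ih.biUnion (t := fun X' : IsoCls C =>
      {X : IsoCls C | X.out ∈ Wt ∧ ∃ π : X.out ⟶ X'.out, IsSimpleEpi π})
        (fun X' hX' => hWtn X'.out hX'.1)).union (Set.finite_singleton (cls Hb))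
    refine hfin.subset ?_
    rintro X ⟨hX, π, hπ⟩
    haveI := hC.quotFinite X.out
    letI := qLat hC X.out
    rcases eq_top_or_exists_le_coatom (quotOf π.1 π.2) with h | ⟨Y, hY, hle⟩
    · right
      rw [quotOf_eq_top_iff] at h
      haveI := h
      exact cls_eq_of_iso (asIso π.1)
    · left
      obtain ⟨i⟩ := cls_out_iso (qObj Y)
      have hs : Epi (pr Y ≫ i.inv) := epiComp (pr_epi Y) inferInstance
      have hsY : quotOf (pr Y ≫ i.inv) hs = Y := by
        conv_rhs => rw [← quotOf_pr Y]
        rw [quotOf_eq_iff]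
        exact ⟨i.symm, rfl⟩
      have hle' := hle
      rw [← hsY, quotOf_le_iff] at hle'
      obtain ⟨r, hr⟩ := hle'
      have hr' : Epi r := epi_of_comp (π := pr Y ≫ i.inv) (by rw [hr]; exact π.2)
      have hYW : (cls (qObj Y)).out ∈ Wt := hWtF.1 _ hX _ _ hs
      have hpr : pull _ hs (quotOf r hr') = quotOf π.1 π.2 := by
        rw [pull_quotOf]
        rw [quotOf_eq_iff]
        exact ⟨Iso.refl _, by simp [← hr]⟩
      rw [Set.mem_iUnion₂]
      refine ⟨cls (qObj Y), ⟨hYW, ⟨r, hr'⟩, ?_⟩, hX, pr Y ≫ i.inv, hs, ?_, ?_⟩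
      · have hlt : Nat.card {b : Quotients (cls (qObj Y)).out // quotOf r hr' ≤ b} <
            Nat.card {a : Quotients X.out // quotOf π.1 π.2 ≤ a} := by
          letI : Fintype {a : Quotients X.out // quotOf π.1 π.2 ≤ a} := Fintype.ofFinite _
          haveI := hC.quotFinite (cls (qObj Y)).out
          letI : Fintype {b : Quotients (cls (qObj Y)).out // quotOf r hr' ≤ b} :=
            Fintype.ofFinite _
          rw [Nat.card_eq_fintype_card, Nat.card_eq_fintype_card]
          refine Fintype.card_lt_of_injective_of_notMem
            (fun b => ⟨pull _ hs b.1, by rw [← hpr, pull_le_iff]; exact b.2⟩) ?_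
            (b := ⟨⊤, le_top⟩) ?_
          · intro b c h
            exact Subtype.ext (pull_inj hs (congrArg Subtype.val h))
          · rintro ⟨b, hb⟩
            have hb' : pull _ hs b.1 = ⊤ := congrArg Subtype.val hb
            have : pull _ hs b.1 ≤ Y := by
              conv_rhs => rw [← hsY, ← pull_top]
              rw [pull_le_iff]; exact le_top
            rw [hb'] at this
            exact hY.1 (top_le_iff.1 this)
        exact Nat.lt_succ_iff.1 (lt_of_lt_of_le hlt hπ)
      · rw [← quotOf_eq_top_iff _ hs, hsY]; exact hY.1
      · intro Z hZ
        rw [hsY] at hZ ⊢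
        rcases hZ.eq_or_lt with h | h
        · left; exact h.symm
        · right; exact hY.2 Z h

/-- The finite set of isomorphism classes through which everything factors. -/
def KK (Wt : Set C) (Hb E : C) : Set (IsoCls C) :=
  {X : IsoCls C | X.out ∈ Wt ∧ ∃ (r : Epis X.out Hb) (t : Epis X.out E),
    qSup (quotOf r.1 r.2) (quotOf t.1 t.2) = ⊤}

theorem KK_finite (hC : IsDiamond C) {Wt : Set C} (hWtn : Narrow Wt)
    (hWtF : IsFormation Wt) (Hb E : C) : (KK Wt Hb E).Finite := by
  refine (finite_above hC hWtn hWtF Hb (Nat.card (Quotients E))).subset ?_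
  rintro X ⟨hX, r, t, h⟩
  refine ⟨hX, r, ?_⟩
  haveI := hC.quotFinite E
  letI := qLat hC X.out
  haveI := qMod hC X.out
  have hT : quotOf r.1 r.2 ⊔ quotOf t.1 t.2 = ⊤ := h
  have hex : ∀ a : Quotients X.out, ∃ b, pull t.1 t.2 b = a ⊓ quotOf t.1 t.2 := fun a =>
    exists_pull t.2 inf_le_right
  choose f hf using hex
  refine Nat.card_le_card_of_injective (fun a => f a.1) ?_
  intro a b hab
  have hab' : f a.1 = f b.1 := hab
  have key : ∀ x : Quotients X.out, quotOf r.1 r.2 ≤ x →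
      x = quotOf r.1 r.2 ⊔ (quotOf t.1 t.2 ⊓ x) := by
    intro x hx
    rw [← sup_inf_assoc_of_le _ hx, hT, top_inf_eq]
  apply Subtype.ext
  rw [key a.1 a.2, key b.1 b.2, inf_comm _ a.1, inf_comm _ b.1, ← hf, ← hf, hab']

theorem Epis_finite (hC : IsDiamond C) (K E : C) : Finite (Epis K E) := by
  haveI := hC.quotFinite K
  haveI : Finite (E ≅ E) := hC.autFinite E
  refine Set.finite_univ_iff.1 (Set.Finite.of_finite_fibers
    (fun π : Epis K E => quotOf π.1 π.2) (Set.toFinite _) ?_)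
  intro a _
  rw [Set.univ_inter]
  rcases Set.eq_empty_or_nonempty ((fun π : Epis K E => quotOf π.1 π.2) ⁻¹' {a}) with h | ⟨π0, h0⟩
  · rw [h]; exact Set.finite_empty
  · refine (Set.finite_range (fun α : E ≅ E =>
      (⟨π0.1 ≫ α.hom, epiComp π0.2 inferInstance⟩ : Epis K E))).subset ?_
    intro π hπ
    have he : quotOf π.1 π.2 = quotOf π0.1 π0.2 := Eq.trans hπ (Eq.symm h0)
    obtain ⟨i, hi⟩ := (quotOf_eq_iff _ _).1 he
    exact ⟨i, Subtype.ext hi⟩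

theorem mem_of_relative (hC : IsDiamond C) {W Wt : Set C} (hWF : IsFormation W)
    (hWtF : IsFormation Wt) (hWWt : W ⊆ Wt) {E : C} (hE : E ∈ Wt) {G : C} (φ : G ⟶ E) (h : Epi φ)
    (hr : RelativeW W φ h) : G ∈ Wt := by
  have h1 : qObj (⊤ : Quotients G) ∈ Wt := by
    rw [← hr]
    exact hWtF.qSup_mem hC (hWWt (wQuot_spec hC hWF G).1)
      (hWtF.iso hE (qObj_quotOf φ h).some.symm)
  rw [← quotOf_id G inferInstance] at h1
  exact hWtF.iso h1 (qObj_quotOf _ _).some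

/-- The condition describing the pairs (quotient, map to `E`) in the sum. -/
def PCond (Wb W : Set C) (Hb : C) {E : C} {G : C} (p : Quotients G × Epis G E) : Prop :=
  RelativeW W p.2.1 p.2.2 ∧ quotOf p.2.1 p.2.2 ≤ p.1 ∧
    Nonempty (qObj (qInf p.1 (wQuot Wb G)) ≅ Hb)

theorem exists_factor (hC : IsDiamond C)
    {mob : ∀ G : C, Quotients G → Quotients G → ℝ} (hmob : IsMobiusFamily mob)
    {Wb W : Set C} (hWbF : IsFormation Wb) (hWF : IsFormation W) (hsub : Wb ⊆ W)
    (hss : ∀ G ∈ W, IntervalComplTop (wQuot Wb G))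
    {E Hb : C} (hHb : Hb ∈ Wb) {Wt : Set C} (hWtF : IsFormation Wt)
    (hWWt : W ⊆ Wt) (hE : E ∈ Wt) {G : C} (p : Quotients G × Epis G E)
    (hp : PCond Wb W Hb p) (hμ : mob G p.1 ⊤ ≠ 0) :
    ∃ (j : KK Wt Hb E) (σ : Epis G j.1.out) (τ : Epis j.1.out E),
      SS (quotOf σ.1 σ.2) ∧ quotOf σ.1 σ.2 ≤ p.1 ∧ σ.1 ≫ τ.1 = p.2.1 := by
  obtain ⟨a, φ, hφ⟩ := p
  obtain ⟨hr, hle, ⟨iH⟩⟩ := hp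
  dsimp only at hr hle iH hμ ⊢
  letI := qLat hC G
  haveI := qMod hC G
  set e := quotOf φ hφ with he
  set v := wQuot Wb G with hv
  have hK : qSup (qInf a v) e = qInf a (qSup v e) := by
    change (a ⊓ v) ⊔ e = a ⊓ (v ⊔ e)
    exact inf_sup_assoc_of_le v hle
  set K := qSup (qInf a v) e with hKdef
  have hKSS : SS K := by
    rw [hK]
    exact SS_qInf hC (SS_of_mob_ne_zero hC hmob a hμ) (SS_join hC hWbF hWF hsub hss e hr)
  have hKa : K ≤ a := by
    rw [hK]; exact (inf_le_left : a ⊓ (v ⊔ e) ≤ a)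
  have hKe : e ≤ K := (le_sup_right : e ≤ (a ⊓ v) ⊔ e)
  have hKh : qInf a v ≤ K := (le_sup_left : (a ⊓ v) ≤ (a ⊓ v) ⊔ e)
  have hKW : qObj K ∈ Wt := hWtF.qSup_mem hC (hWtF.iso (hWWt (hsub hHb)) iH.symm)
    (hWtF.iso hE (qObj_quotOf φ hφ).some.symm)
  obtain ⟨i⟩ := cls_out_iso (qObj K)
  have hs : Epi (pr K ≫ i.inv) := epiComp (pr_epi K) inferInstance
  have hsK : quotOf (pr K ≫ i.inv) hs = K := by
    conv_rhs => rw [← quotOf_pr K]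
    rw [quotOf_eq_iff]
    exact ⟨i.symm, rfl⟩
  obtain ⟨t, ht⟩ := (quotOf_le_iff hφ hs).1 (by rw [hsK]; exact hKe)
  have ht' : Epi t := epi_of_comp (π := pr K ≫ i.inv) (by rw [ht]; exact hφ)
  have hh : Epi (pr (qInf a v) ≫ iH.hom) := epiComp (pr_epi _) inferInstance
  have hhq : quotOf (pr (qInf a v) ≫ iH.hom) hh = qInf a v := by
    conv_rhs => rw [← quotOf_pr (qInf a v)]
    rw [quotOf_eq_iff]
    exact ⟨iH, rfl⟩
  obtain ⟨r, hr2⟩ := (quotOf_le_iff hh hs).1 (by rw [hsK, hhq]; exact hKh)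
  have hr' : Epi r := epi_of_comp (π := pr K ≫ i.inv) (by rw [hr2]; exact hh)
  refine ⟨⟨cls (qObj K), hWtF.iso hKW i.symm, ⟨r, hr'⟩, ⟨t, ht'⟩, ?_⟩, ⟨_, hs⟩, ⟨t, ht'⟩, ?_, ?_,
    ht⟩
  · apply pull_inj hs
    rw [pull_qSup hC, pull_quotOf, pull_quotOf, pull_top, hsK]
    have e1 : quotOf ((pr K ≫ i.inv) ≫ r) (epiComp hs hr') = qInf a v := by
      rw [← hhq, quotOf_eq_iff]
      exact ⟨Iso.refl _, by simp [← hr2]⟩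
    have e2 : quotOf ((pr K ≫ i.inv) ≫ t) (epiComp hs ht') = e := by
      rw [he, quotOf_eq_iff]
      exact ⟨Iso.refl _, by simp [← ht]⟩
    rw [e1, e2]
  · dsimp only; rw [hsK]; exact hKSS
  · dsimp only; rw [hsK]; exact hKa

/-- The index type over a fixed object `G`. -/
abbrev RIdx (Wb W : Set C) (Hb E G : C) :=
  Σ (F : {X : IsoCls C // Nonempty (qObj (wQuot Wb X.out) ≅ Hb)}) (π : Epis G F.1.out),
    {ρ : Epis F.1.out E // RelativeW W (π.1 ≫ ρ.1) (epiComp π.2 ρ.2)}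

/-- The map sending an index to the quotient and the composite map to `E`. -/
noncomputable def toP {Wb W : Set C} {Hb E G : C} (r : RIdx Wb W Hb E G) :
    Quotients G × Epis G E :=
  (quotOf r.2.1.1 r.2.1.2, ⟨r.2.1.1 ≫ r.2.2.1.1, epiComp r.2.1.2 r.2.2.1.2⟩)

theorem PCond_toP (hC : IsDiamond C) {Wb W : Set C} (hWbF : IsFormation Wb) {Hb E G : C}
    (r : RIdx Wb W Hb E G) : PCond Wb W Hb (toP r) := by
  obtain ⟨⟨F, ⟨i⟩⟩, ⟨π, hπ⟩, ⟨ρ, hρ⟩, hr⟩ := r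
  refine ⟨hr, ?_, ?_⟩
  · exact (quotOf_le_iff _ hπ).2 ⟨ρ, rfl⟩
  · change Nonempty (qObj (qInf (quotOf π hπ) (wQuot Wb G)) ≅ Hb)
    rw [← pull_wQuot hC hWbF hπ]
    obtain ⟨j⟩ := qObj_pull hπ (wQuot Wb F.out)
    exact ⟨j ≪≫ i⟩

theorem step1 (hC : IsDiamond C) (mob : ∀ G : C, Quotients G → Quotients G → ℝ)
    {Wb W : Set C} (hWbF : IsFormation Wb) (Hb E G : C) :
    ∑' r : RIdx Wb W Hb E G, ENNReal.ofReal
      (|mob G (quotOf r.2.1.1 r.2.1.2) ⊤| / (Nat.card (Aut r.1.1.out) : ℝ)) ≤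
    ∑' p : Quotients G × Epis G E,
      if PCond Wb W Hb p then ENNReal.ofReal |mob G p.1 ⊤| else 0 := by
  rw [← ENNReal.tsum_fiberwise _ (toP (Wb := Wb) (W := W) (Hb := Hb) (E := E) (G := G))]
  refine ENNReal.tsum_le_tsum ?_
  intro p
  rcases Set.eq_empty_or_nonempty (toP (Wb := Wb) (W := W) (Hb := Hb) (E := E) (G := G) ⁻¹' {p})
    with h | ⟨r0, h0⟩
  · rw [h]; simp
  have h0' : toP r0 = p := h0
  subst h0'
  rw [if_pos (PCond_toP hC hWbF r0)]
  obtain ⟨F0, ⟨π0, hπ0⟩, ⟨ρ0, hρ0⟩, hr0⟩ := r0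
  haveI : Finite (F0.1.out ≅ F0.1.out) := hC.autFinite F0.1.out
  have hq : ∀ α : F0.1.out ≅ F0.1.out, quotOf (π0 ≫ α.hom) (epiComp hπ0 inferInstance) = quotOf π0 hπ0 :=
    fun α => (quotOf_eq_iff _ _).2 ⟨α, rfl⟩
  have hcomp : ∀ α : F0.1.out ≅ F0.1.out, (π0 ≫ α.hom) ≫ (α.inv ≫ ρ0) = π0 ≫ ρ0 := by
    intro α; simp
  have hrel : ∀ α : F0.1.out ≅ F0.1.out, RelativeW W ((π0 ≫ α.hom) ≫ (α.inv ≫ ρ0))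
      (epiComp (epiComp hπ0 inferInstance) (epiComp inferInstance hρ0)) := by
    intro α
    have : ∀ (φ ψ : G ⟶ E) (h : Epi φ) (h' : Epi ψ), φ = ψ → RelativeW W ψ h' →
        RelativeW W φ h := by
      intro φ ψ h h' e; subst e; exact id
    exact this _ _ _ (epiComp hπ0 hρ0) (hcomp α) hr0
  let s : (F0.1.out ≅ F0.1.out) → toP (Wb := Wb) (W := W) (Hb := Hb) (E := E) (G := G) ⁻¹'
      {toP ⟨F0, ⟨π0, hπ0⟩, ⟨ρ0, hρ0⟩, hr0⟩} := fun α =>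
    ⟨⟨F0, ⟨π0 ≫ α.hom, epiComp hπ0 inferInstance⟩, ⟨α.inv ≫ ρ0, epiComp inferInstance hρ0⟩, hrel α⟩,
      Prod.ext (hq α) (Subtype.ext (hcomp α))⟩
  have hs : Function.Surjective s := by
    rintro ⟨⟨⟨F, hF⟩, ⟨π, hπ⟩, ⟨ρ, hρ⟩, hr⟩, hmem⟩
    have e1 : quotOf π hπ = quotOf π0 hπ0 := congrArg Prod.fst hmem
    have e2 : π ≫ ρ = π0 ≫ ρ0 := congrArg (fun z => z.2.1) hmem
    obtain ⟨i, hi⟩ := (quotOf_eq_iff _ _).1 e1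
    obtain ⟨F0, hF0⟩ := F0
    have hFF : F0 = F := by
      exact (cls_eq_of_iso (X := F0) i).trans (Quotient.out_eq F)
    subst hFF
    refine ⟨i, ?_⟩
    subst hi
    have e3 : ρ = i.inv ≫ ρ0 := by
      haveI := hπ0
      rw [Category.assoc, cancel_epi] at e2
      rw [← e2]; simp
    subst e3
    rfl
  refine (ENNReal.tsum_le_tsum_comp_of_surjective hs _).trans ?_
  have hval : ∀ α : F0.1.out ≅ F0.1.out, ENNReal.ofReal (|mob G (quotOf (s α).1.2.1.1 (s α).1.2.1.2) ⊤| /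
      (Nat.card (Aut (s α).1.1.1.out) : ℝ)) =
      ENNReal.ofReal (|mob G (quotOf π0 hπ0) ⊤| / (Nat.card (Aut F0.1.out) : ℝ)) := by
    intro α
    change ENNReal.ofReal (|mob G (quotOf (π0 ≫ α.hom) _) ⊤| / _) = _
    rw [hq α]
  rw [tsum_congr hval]
  change ∑' _ : F0.1.out ≅ F0.1.out, ENNReal.ofReal (|mob G (quotOf π0 hπ0) ⊤| /
    (Nat.card (F0.1.out ≅ F0.1.out) : ℝ)) ≤ ENNReal.ofReal |mob G (quotOf π0 hπ0) ⊤|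
  letI : Fintype (F0.1.out ≅ F0.1.out) := Fintype.ofFinite _
  rw [tsum_fintype, Finset.sum_const, Finset.card_univ, ← Nat.card_eq_fintype_card, nsmul_eq_mul,
    ← ENNReal.ofReal_natCast, ← ENNReal.ofReal_mul (by positivity)]
  have hpos : (Nat.card (F0.1.out ≅ F0.1.out) : ℝ) ≠ 0 := by
    haveI : Nonempty (F0.1.out ≅ F0.1.out) := ⟨Iso.refl _⟩
    have : 0 < Nat.card (F0.1.out ≅ F0.1.out) := Nat.card_pos
    positivity
  rw [mul_div_cancel₀ _ hpos]

theorem step2 (hC : IsDiamond C)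
    {mob : ∀ G : C, Quotients G → Quotients G → ℝ} (hmob : IsMobiusFamily mob)
    {Wb W : Set C} (hWbF : IsFormation Wb) (hWF : IsFormation W) (hsub : Wb ⊆ W)
    (hss : ∀ G ∈ W, IntervalComplTop (wQuot Wb G))
    {E Hb : C} (hHb : Hb ∈ Wb) {Wt : Set C} (hWtF : IsFormation Wt)
    (hWWt : W ⊆ Wt) (hE : E ∈ Wt) (G : C) :
    (∑' p : Quotients G × Epis G E,
      if PCond Wb W Hb p then ENNReal.ofReal |mob G p.1 ⊤| else 0) ≤
    ∑' k : Σ j : KK Wt Hb E, Epis G j.1.out × Epis j.1.out E,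
      ENNReal.ofReal ((Zfn k.2.1.1 k.2.1.2 : ℝ) ^ 3 * |mob G (quotOf k.2.1.1 k.2.1.2) ⊤|) := by
  let rel : (Quotients G × Epis G E) → (Σ j : KK Wt Hb E, Epis G j.1.out × Epis j.1.out E) → Prop :=
    fun p k => SS (quotOf k.2.1.1 k.2.1.2) ∧ quotOf k.2.1.1 k.2.1.2 ≤ p.1 ∧
      k.2.1.1 ≫ k.2.2.1 = p.2.1
  calc (∑' p : Quotients G × Epis G E,
      if PCond Wb W Hb p then ENNReal.ofReal |mob G p.1 ⊤| else 0)
      ≤ ∑' p : Quotients G × Epis G E, ∑' k, if rel p k then ENNReal.ofReal |mob G p.1 ⊤| else 0 := by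
        refine ENNReal.tsum_le_tsum ?_
        intro p
        split_ifs with h
        · by_cases hμ : mob G p.1 ⊤ = 0
          · rw [hμ]; simp
          · obtain ⟨j, σ, τ, hrel⟩ := exists_factor hC hmob hWbF hWF hsub hss hHb hWtF hWWt hE p h hμ
            have := ENNReal.le_tsum (f := fun k => if rel p k then ENNReal.ofReal |mob G p.1 ⊤| else 0)
              ⟨j, σ, τ⟩
            refine le_trans ?_ this
            rw [if_pos]
            exact hrel
        · exact zero_le
    _ = ∑' k, ∑' p : Quotients G × Epis G E, if rel p k then ENNReal.ofReal |mob G p.1 ⊤| else 0 :=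
        ENNReal.tsum_comm
    _ ≤ _ := by
        refine ENNReal.tsum_le_tsum ?_
        rintro ⟨j, σ, τ⟩
        by_cases hS : SS (quotOf σ.1 σ.2)
        · letI : Fintype (Quotients G) := @Fintype.ofFinite _ (hC.quotFinite G)
          refine le_trans ?_ (ENNReal.ofReal_le_ofReal (bound_Z hC hmob σ.1 σ.2 hS))
          rw [ENNReal.tsum_prod', tsum_fintype, ENNReal.ofReal_sum_of_nonneg
            (fun _ _ => abs_nonneg _), Finset.sum_filter]
          refine Finset.sum_le_sum ?_
          intro a _
          rw [tsum_eq_single (⟨σ.1 ≫ τ.1, epiComp σ.2 τ.2⟩ : Epis G E)]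
          · by_cases ha : quotOf σ.1 σ.2 ≤ a
            · rw [if_pos ha]
              split_ifs
              · exact le_rfl
              · exact zero_le
            · rw [if_neg ha, if_neg]
              exact fun h => ha h.2.1
          · intro φ hφ
            rw [if_neg]
            exact fun h => hφ (Subtype.ext h.2.2.symm)
        · have : ∀ p : Quotients G × Epis G E, (if rel p ⟨j, σ, τ⟩ then
              ENNReal.ofReal |mob G p.1 ⊤| else 0) = 0 := by
            intro p
            rw [if_neg]
            exact fun h => hS h.1
          rw [tsum_congr this, tsum_zero]
          exact zero_le
end MomentCat
open MomentCat in
/-- Proposition 4.7: with `W̄ ⊆ W` narrow formations such that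
`G → G^{W̄}` is semisimple for every `G ∈ W`, `E` an object, `H̄ ∈ W̄`, and
`(M_G)` well-behaved at a narrow formation `W̃ ⊇ W` with `E ∈ W̃`, the sum
`∑_{G} ∑_{F : F^{W̄} ≅ H̄} ∑_{π ∈ Epi(G,F)} ∑_{ρ ∈ Epi(F,E), ρπ relative-W}
|μ(π) M_G|/(|Aut F| |Aut G|)` is finite. -/
theorem statement7 {C : Type u} [SmallCategory C] (hC : IsDiamond C)
    (mob : ∀ G : C, Quotients G → Quotients G → ℝ) (hmob : IsMobiusFamily mob)
    (Wb W : Set C) (hWbF : IsFormation Wb) (hWF : IsFormation W) (hsub : Wb ⊆ W)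
    (hWbn : Narrow Wb) (hWn : Narrow W)
    (hss : ∀ G ∈ W, IntervalComplTop (wQuot Wb G))
    (E Hb : C) (hHb : Hb ∈ Wb)
    (Wt : Set C) (hWtF : IsFormation Wt) (hWtn : Narrow Wt)
    (hWWt : W ⊆ Wt) (hE : E ∈ Wt)
    (M : IsoCls C → ℝ) (hwb : WellBehavedAt mob M Wt) :
    Summable (fun q :
        Σ (G : IsoCls C) (F : {X : IsoCls C // Nonempty (qObj (wQuot Wb X.out) ≅ Hb)})
          (π : Epis G.out F.1.out),
          {ρ : Epis F.1.out E // RelativeW W (π.1 ≫ ρ.1) (epiComp π.2 ρ.2)} =>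
      |mob q.1.out (quotOf q.2.2.1.1 q.2.2.1.2) ⊤ * M q.1| /
        ((Nat.card (Aut q.2.1.1.out) : ℝ) * (Nat.card (Aut q.1.out) : ℝ))) := by
  set t : (Σ (G : IsoCls C), RIdx Wb W Hb E G.out) → ℝ := fun q =>
      |mob q.1.out (quotOf q.2.2.1.1 q.2.2.1.2) ⊤ * M q.1| /
        ((Nat.card (Aut q.2.1.1.out) : ℝ) * (Nat.card (Aut q.1.out) : ℝ)) with ht
  change Summable t
  have ht0 : ∀ q, 0 ≤ t q := fun q => by rw [ht]; positivity
  suffices H : ∑' q, ENNReal.ofReal (t q) ≠ ∞ by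
    have := ENNReal.summable_toReal H
    refine this.congr ?_
    intro q
    rw [ENNReal.toReal_ofReal (ht0 q)]
  let A : IsoCls C → ℝ≥0∞ := fun G => ENNReal.ofReal (|M G| / (Nat.card (Aut G.out) : ℝ))
  let D : ∀ (G : IsoCls C) (j : C), Epis G.out j → ℝ≥0∞ := fun G j σ =>
    ENNReal.ofReal (|mob G.out (quotOf σ.1 σ.2) ⊤| / (Nat.card (Aut G.out) : ℝ)
      * ((Zfn σ.1 σ.2 : ℝ)) ^ 3 * |M G|)
  have hAt : ∀ (G : IsoCls C) (r : RIdx Wb W Hb E G.out), ENNReal.ofReal (t ⟨G, r⟩) =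
      A G * ENNReal.ofReal
      (|mob G.out (quotOf r.2.1.1 r.2.1.2) ⊤| / (Nat.card (Aut r.1.1.out) : ℝ)) := by
    intro G r
    rw [← ENNReal.ofReal_mul (by positivity)]
    congr 1
    change |mob G.out (quotOf r.2.1.1 r.2.1.2) ⊤ * M G| /
        ((Nat.card (Aut r.1.1.out) : ℝ) * (Nat.card (Aut G.out) : ℝ)) = _
    rw [abs_mul]
    field_simp
  have hAD : ∀ (G : IsoCls C) (j : C) (σ : Epis G.out j), A G *
      ENNReal.ofReal ((Zfn σ.1 σ.2 : ℝ) ^ 3 * |mob G.out (quotOf σ.1 σ.2) ⊤|) = D G j σ := by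
    intro G j σ
    rw [← ENNReal.ofReal_mul (by positivity)]
    congr 1
    ring
  have hG : ∀ G : IsoCls C, ∑' r : RIdx Wb W Hb E G.out, ENNReal.ofReal (t ⟨G, r⟩) ≤
      ∑' j : KK Wt Hb E, ∑' τ : Epis j.1.out E, ∑' σ : Epis G.out j.1.out, D G j.1.out σ := by
    intro G
    rw [tsum_congr (hAt G), ENNReal.tsum_mul_left]
    refine (mul_le_mul_right ((step1 hC mob hWbF Hb E G.out).trans
      (step2 hC hmob hWbF hWF hsub hss hHb hWtF hWWt hE G.out)) _).trans ?_
    rw [← ENNReal.tsum_mul_left, ENNReal.tsum_sigma']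
    refine ENNReal.tsum_le_tsum ?_
    intro j
    rw [ENNReal.tsum_prod', ENNReal.tsum_comm]
    refine ENNReal.tsum_le_tsum ?_
    intro τ
    refine ENNReal.tsum_le_tsum ?_
    intro σ
    exact (hAD G j.1.out σ).le
  have hsupp : Function.support (fun G : IsoCls C =>
      ∑' r : RIdx Wb W Hb E G.out, ENNReal.ofReal (t ⟨G, r⟩)) ⊆ {X : IsoCls C | X.out ∈ Wt} := by
    intro G hGne
    by_contra hGW
    apply hGne
    have : IsEmpty (RIdx Wb W Hb E G.out) := ⟨fun r => hGW
      (mem_of_relative hC hWF hWtF hWWt hE _ _ r.2.2.2)⟩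
    exact tsum_empty
  rw [ENNReal.tsum_sigma', ← tsum_subtype_eq_of_support_subset hsupp]
  refine ne_top_of_le_ne_top ?_ (ENNReal.tsum_le_tsum (fun G : WSub Wt => hG G.1))
  rw [ENNReal.tsum_comm]
  haveI : Finite (KK Wt Hb E) := (KK_finite hC hWtn hWtF Hb E).to_subtype
  letI : Fintype (KK Wt Hb E) := Fintype.ofFinite _
  rw [tsum_fintype, ENNReal.sum_ne_top]
  intro j _
  rw [ENNReal.tsum_comm]
  haveI := Epis_finite hC j.1.out E
  letI : Fintype (Epis j.1.out E) := Fintype.ofFinite _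
  rw [tsum_fintype, ENNReal.sum_ne_top]
  intro τ _
  have h1 := (hwb j.1.out j.2.1).tsum_ofReal_ne_top
  rw [ENNReal.tsum_sigma'] at h1
  exact h1
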